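/- arXiv:dg-ga/9707023 — 3 statements merged into one kernel-verified Lean document; each statement's English description precedes it below -/
import Mathlib

section
/- Let 𝔓 be a polyhedral subdivision of a vector space V ≅ ℝⁿ: a finite collection of convex polyhedra whose union is V, closed under taking faces, and such that the intersection of any two members is a common face. Then ∑_{P ∈ 𝔓} (−1)^{codim P} = 1 (the Euler identity). -/
open Module Filter Topology

section EulerPolyhedral

variable {V : Type*} [AddCommGroup V] [Module ℝ V]

/-- The algebraic relative interior of a set: the points from which one can move slightly further
away from any other point of the set. -/
def algRelInterior (P : Set V) : Set V :=
  {x | x ∈ P ∧ ∀ y ∈ P, ∃ ε : ℝ, 0 < ε ∧ x + ε • (x - y) ∈ P}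

/-- A convex set that coincides with its algebraic relative interior. -/
def IsRelOpen (R : Set V) : Prop :=
  Convex ℝ R ∧ ∀ x ∈ R, ∀ y ∈ R, ∃ ε : ℝ, 0 < ε ∧ x + ε • (x - y) ∈ R

open scoped Classical in
/-- `(-1) ^ dim R` for nonempty `R`, and `0` for the empty set. -/
noncomputable def eulerSign (R : Set V) : ℤ :=
  if R.Nonempty then (-1) ^ finrank ℝ (vectorSpan ℝ R) else 0

theorem eulerSign_empty : eulerSign (∅ : Set V) = 0 := by
  simp [eulerSign]

theorem eulerSign_of_nonempty {R : Set V} (h : R.Nonempty) :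
    eulerSign R = (-1) ^ finrank ℝ (vectorSpan ℝ R) := if_pos h

theorem isRelOpen_univ : IsRelOpen (Set.univ : Set V) :=
  ⟨convex_univ, fun _ _ _ _ => ⟨1, one_pos, trivial⟩⟩

theorem IsRelOpen.inter {R S : Set V} (hR : IsRelOpen R) (hS : IsRelOpen S) :
    IsRelOpen (R ∩ S) := by
  refine ⟨hR.1.inter hS.1, fun x hx y hy => ?_⟩
  obtain ⟨ε, hε, h⟩ := hR.2 x hx.1 y hy.1
  obtain ⟨δ, hδ, h'⟩ := hS.2 x hx.2 y hy.2
  have shrink : ∀ {T : Set V} {η : ℝ}, Convex ℝ T → x ∈ T → 0 < η → x + η • (x - y) ∈ T →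
      min ε δ ≤ η → x + min ε δ • (x - y) ∈ T := by
    intro T η hT hxT hη h hle
    have := hT.add_smul_mem hxT h (t := min ε δ / η)
      ⟨by positivity, (div_le_one hη).2 hle⟩
    rwa [smul_smul, div_mul_cancel₀ _ hη.ne'] at this
  exact ⟨min ε δ, lt_min hε hδ, shrink hR.1 hx.1 hε h (min_le_left _ _),
    shrink hS.1 hx.2 hδ h' (min_le_right _ _)⟩

theorem isRelOpen_setOf_lt (g : V →ₗ[ℝ] ℝ) (c : ℝ) : IsRelOpen {x | c < g x} := by
  refine ⟨convex_halfSpace_gt g.isLinear c, fun x hx y hy => ?_⟩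
  simp only [Set.mem_ofPred_eq, map_add, map_smul, map_sub, smul_eq_mul] at *
  rcases le_or_gt (g y) (g x) with h | h
  · exact ⟨1, one_pos, by linarith⟩
  · have hd : 0 < g y - g x := by linarith
    refine ⟨(g x - c) / (2 * (g y - g x)), div_pos (by linarith) (by linarith), ?_⟩
    have : (g x - c) / (2 * (g y - g x)) * (g x - g y) = -((g x - c) / 2) := by
      field_simp
      ring
    linarith

theorem isRelOpen_setOf_gt (g : V →ₗ[ℝ] ℝ) (c : ℝ) : IsRelOpen {x | g x < c} := by
  simpa using isRelOpen_setOf_lt (-g) (-c)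

theorem isRelOpen_setOf_eq (g : V →ₗ[ℝ] ℝ) (c : ℝ) : IsRelOpen {x | g x = c} := by
  refine ⟨convex_hyperplane g.isLinear c, fun x hx y hy => ⟨1, one_pos, ?_⟩⟩
  simp only [Set.mem_ofPred_eq, map_add, map_smul, map_sub, smul_eq_mul] at *
  rw [hx, hy]
  ring

theorem vectorSpan_eq_of_forall_exists_smul {R S : Set V} (hSR : S ⊆ R) {a : V} (ha : a ∈ S)
    (h : ∀ y ∈ R, ∃ t : ℝ, 0 < t ∧ a + t • (y - a) ∈ S) : vectorSpan ℝ S = vectorSpan ℝ R := by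
  refine le_antisymm (vectorSpan_mono ℝ hSR) ?_
  rw [vectorSpan_eq_span_vsub_set_right ℝ (hSR ha), Submodule.span_le]
  rintro _ ⟨y, hy, rfl⟩
  obtain ⟨t, ht, hmem⟩ := h y hy
  have := Submodule.smul_mem _ t⁻¹ (vsub_mem_vectorSpan ℝ hmem ha)
  simpa [smul_smul, inv_mul_cancel₀ ht.ne'] using this

theorem vectorSpan_inter_setOf_lt {R : Set V} (hR : Convex ℝ R) (g : V →ₗ[ℝ] ℝ) {c : ℝ} {a : V}
    (ha : a ∈ R) (hga : c < g a) : vectorSpan ℝ (R ∩ {x | c < g x}) = vectorSpan ℝ R := by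
  refine vectorSpan_eq_of_forall_exists_smul Set.inter_subset_left ⟨ha, hga⟩ fun y hy => ?_
  have hd : 0 < g a - c := by linarith
  have hpos : 0 < g a - c + |g y - g a| := by positivity
  set t := (g a - c) / (2 * (g a - c + |g y - g a|)) with ht
  have ht0 : 0 < t := by positivity
  have ht1 : t ≤ 1 := by
    rw [ht, div_le_one (by positivity)]
    nlinarith [abs_nonneg (g y - g a)]
  have hmul : t * (g a - c + |g y - g a|) = (g a - c) / 2 := by
    rw [ht]
    field_simp
  refine ⟨t, ht0, hR.add_smul_sub_mem ha hy ⟨ht0.le, ht1⟩, ?_⟩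
  simp only [Set.mem_ofPred_eq, map_add, map_smul, map_sub, smul_eq_mul]
  nlinarith [neg_abs_le (g y - g a), mul_pos ht0 hd,
    mul_le_mul_of_nonneg_left (neg_abs_le (g y - g a)) ht0.le]

theorem vectorSpan_inter_setOf_gt {R : Set V} (hR : Convex ℝ R) (g : V →ₗ[ℝ] ℝ) {c : ℝ} {a : V}
    (ha : a ∈ R) (hga : g a < c) : vectorSpan ℝ (R ∩ {x | g x < c}) = vectorSpan ℝ R := by
  simpa using vectorSpan_inter_setOf_lt hR (-g) (c := -c) ha (by simpa using hga)

theorem vectorSpan_inter_setOf_eq {R : Set V} (hR : IsRelOpen R) (g : V →ₗ[ℝ] ℝ) {c : ℝ}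
    {a z : V} (ha : a ∈ R) (hga : c < g a) (hz : z ∈ R) (hgz : g z = c) :
    vectorSpan ℝ R = vectorSpan ℝ (R ∩ {x | g x = c}) ⊔ Submodule.span ℝ {a - z} := by
  have hzS : z ∈ R ∩ {x | g x = c} := ⟨hz, hgz⟩
  refine le_antisymm ?_ (sup_le (vectorSpan_mono ℝ Set.inter_subset_left) ?_)
  · rw [vectorSpan_eq_span_vsub_set_right ℝ hz, Submodule.span_le]
    rintro _ ⟨y, hy, rfl⟩
    obtain ⟨ε, hε, hb⟩ := hR.2 z hz a ha
    have hd : 0 < g a - c := by linarith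
    -- moving from `z` in the direction `y - z`, corrected along `a - z`, stays in `R`
    obtain ⟨μ, q, hμ, hq, hqe⟩ : ∃ (μ : ℝ) (q : V), 0 ≤ μ ∧ q ∈ R ∧
        μ • (q - z) = (-((g y - c) / (g a - c))) • (a - z) := by
      rcases le_total (g y - c) 0 with h | h
      · exact ⟨_, a, neg_nonneg.2 (div_nonpos_of_nonpos_of_nonneg h hd.le), ha, rfl⟩
      · refine ⟨(g y - c) / (g a - c) / ε, _, by positivity, hb, ?_⟩
        rw [add_sub_cancel_left, smul_smul, div_mul_cancel₀ _ hε.ne', neg_smul, ← smul_neg,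
          neg_sub]
    have hmem : z + (1 + μ)⁻¹ • ((y - z) + μ • (q - z)) ∈ R := by
      have hconv : Convex ℝ R := hR.1
      have := hconv hy hq (a := (1 + μ)⁻¹) (b := (1 + μ)⁻¹ * μ) (by positivity) (by positivity)
        (by field_simp)
      convert this using 1
      have h1 : (1 + μ)⁻¹ + (1 + μ)⁻¹ * μ = 1 := by field_simp
      have h2 : z = ((1 + μ)⁻¹ + (1 + μ)⁻¹ * μ) • z := by rw [h1, one_smul]
      nth_rewrite 1 [h2]
      module
    have hg : z + (1 + μ)⁻¹ • ((y - z) + μ • (q - z)) ∈ R ∩ {x | g x = c} := by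
      refine ⟨hmem, ?_⟩
      rw [hqe]
      simp only [Set.mem_ofPred_eq, map_add, map_smul, map_sub, smul_eq_mul, hgz]
      field_simp
      ring
    have hv := Submodule.smul_mem _ (1 + μ) (vsub_mem_vectorSpan ℝ hg hzS)
    rw [vsub_eq_sub, add_sub_cancel_left, smul_smul,
      mul_inv_cancel₀ (by positivity : (1 + μ) ≠ 0), one_smul, hqe] at hv
    have : y -ᵥ z = ((y - z) + (-((g y - c) / (g a - c))) • (a - z)) +
        ((g y - c) / (g a - c)) • (a - z) := by
      rw [vsub_eq_sub]
      module
    rw [SetLike.mem_coe]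
    beta_reduce
    rw [this]
    exact Submodule.add_mem_sup hv (Submodule.smul_mem _ _ (Submodule.mem_span_singleton_self _))
  · rw [Submodule.span_singleton_le_iff_mem]
    exact vsub_mem_vectorSpan ℝ ha hz

theorem finrank_vectorSpan_inter_setOf_eq [FiniteDimensional ℝ V] {R : Set V} (hR : IsRelOpen R)
    (g : V →ₗ[ℝ] ℝ) {c : ℝ} {a z : V} (ha : a ∈ R) (hga : c < g a) (hz : z ∈ R) (hgz : g z = c) :
    finrank ℝ (vectorSpan ℝ R) = finrank ℝ (vectorSpan ℝ (R ∩ {x | g x = c})) + 1 := by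
  have hker : vectorSpan ℝ (R ∩ {x | g x = c}) ≤ LinearMap.ker g := by
    rw [vectorSpan_def, Submodule.span_le]
    rintro _ ⟨x, hx, y, hy, rfl⟩
    have hx2 : g x = c := hx.2
    have hy2 : g y = c := hy.2
    simp [hx2, hy2]
  have hnot : a - z ∉ vectorSpan ℝ (R ∩ {x | g x = c}) := fun h => by
    have := LinearMap.mem_ker.1 (hker h)
    rw [map_sub, hgz] at this
    linarith
  have hne : a - z ≠ 0 := fun h => hnot (h ▸ Submodule.zero_mem _)
  have hdisj : vectorSpan ℝ (R ∩ {x | g x = c}) ⊓ Submodule.span ℝ {a - z} = ⊥ :=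
    ((Submodule.disjoint_span_singleton' hne).2 hnot).eq_bot
  have := Submodule.finrank_sup_add_finrank_inf_eq (vectorSpan ℝ (R ∩ {x | g x = c}))
    (Submodule.span ℝ {a - z})
  rwa [hdisj, finrank_bot, add_zero, finrank_span_singleton hne,
    ← vectorSpan_inter_setOf_eq hR g ha hga hz hgz] at this

/-- Cutting a relatively open convex set by a hyperplane preserves the signed count of pieces. -/
theorem eulerSign_cut [FiniteDimensional ℝ V] {R : Set V} (hR : IsRelOpen R) (g : V →ₗ[ℝ] ℝ)
    (c : ℝ) :
    eulerSign R = eulerSign (R ∩ {x | c < g x}) + eulerSign (R ∩ {x | g x = c}) +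
      eulerSign (R ∩ {x | g x < c}) := by
  by_cases hp : ∃ a ∈ R, c < g a
  · obtain ⟨a, ha, hga⟩ := hp
    by_cases hn : ∃ b ∈ R, g b < c
    · obtain ⟨b, hb, hgb⟩ := hn
      obtain ⟨z, hz, hgz⟩ : ∃ z ∈ R, g z = c := by
        have hd : 0 < g a - g b := by linarith
        have hconv : Convex ℝ R := hR.1
        refine ⟨_, hconv ha hb (a := (c - g b) / (g a - g b)) (b := (g a - c) / (g a - g b))
          (div_nonneg (by linarith) hd.le) (div_nonneg (by linarith) hd.le)
          (by field_simp; ring), ?_⟩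
        simp only [map_add, map_smul, smul_eq_mul]
        field_simp
        ring
      rw [eulerSign_of_nonempty ⟨a, ha⟩,
        eulerSign_of_nonempty (R := R ∩ {x | c < g x}) ⟨a, ha, hga⟩,
        eulerSign_of_nonempty (R := R ∩ {x | g x = c}) ⟨z, hz, hgz⟩,
        eulerSign_of_nonempty (R := R ∩ {x | g x < c}) ⟨b, hb, hgb⟩,
        vectorSpan_inter_setOf_lt hR.1 g ha hga, vectorSpan_inter_setOf_gt hR.1 g hb hgb,
        finrank_vectorSpan_inter_setOf_eq hR g ha hga hz hgz]
      ring
    · push Not at hn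
      have hall : ∀ x ∈ R, c < g x := fun x hx => by
        refine lt_of_le_of_ne (hn x hx) fun hxc => ?_
        obtain ⟨ε, hε, h⟩ := hR.2 x hx a ha
        have := hn _ h
        simp only [map_add, map_smul, map_sub, smul_eq_mul] at this
        nlinarith
      have h1 : R ∩ {x | c < g x} = R := Set.inter_eq_left.2 hall
      have h2 : R ∩ {x | g x = c} = ∅ :=
        Set.eq_empty_of_forall_notMem fun x hx => (hall x hx.1).ne' hx.2
      have h3 : R ∩ {x | g x < c} = ∅ :=
        Set.eq_empty_of_forall_notMem fun x hx => (hall x hx.1).not_gt hx.2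
      rw [h1, h2, h3, eulerSign_empty]
      ring
  · push Not at hp
    have h1 : R ∩ {x | c < g x} = ∅ :=
      Set.eq_empty_of_forall_notMem fun x hx => (hp x hx.1).not_gt hx.2
    by_cases hn : ∃ b ∈ R, g b < c
    · obtain ⟨b, hb, hgb⟩ := hn
      have hall : ∀ x ∈ R, g x < c := fun x hx => by
        refine lt_of_le_of_ne (hp x hx) fun hxc => ?_
        obtain ⟨ε, hε, h⟩ := hR.2 x hx b hb
        have := hp _ h
        simp only [map_add, map_smul, map_sub, smul_eq_mul] at this
        nlinarith
      have h2 : R ∩ {x | g x = c} = ∅ :=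
        Set.eq_empty_of_forall_notMem fun x hx => (hall x hx.1).ne hx.2
      have h3 : R ∩ {x | g x < c} = R := Set.inter_eq_left.2 hall
      rw [h1, h2, h3, eulerSign_empty]
      ring
    · push Not at hn
      have h2 : R ∩ {x | g x = c} = R :=
        Set.inter_eq_left.2 fun x hx => le_antisymm (hp x hx) (hn x hx)
      have h3 : R ∩ {x | g x < c} = ∅ :=
        Set.eq_empty_of_forall_notMem fun x hx => (hn x hx.1).not_gt hx.2
      rw [h1, h2, h3, eulerSign_empty]
      ring

/-- If relatively open sets `S i` partition the relatively open set `R` and membership in each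
`S i` depends only on the signs of finitely many affine functions, then the Euler signs add up. -/
theorem eulerSign_eq_sum_of_partition [FiniteDimensional ℝ V] {ι : Type*} (I : Finset ι)
    (S : ι → Set V) (hS : ∀ i ∈ I, IsRelOpen (S i)) (L : List ((V →ₗ[ℝ] ℝ) × ℝ)) (R : Set V)
    (hR : IsRelOpen R) (hcover : ∀ x ∈ R, ∃ i ∈ I, x ∈ S i)
    (hdisj : ∀ x ∈ R, ∀ i ∈ I, ∀ j ∈ I, x ∈ S i → x ∈ S j → i = j)
    (hsign : ∀ i ∈ I, ∀ x ∈ R, ∀ y ∈ R,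
      (∀ p ∈ L, SignType.sign (p.1 x - p.2) = SignType.sign (p.1 y - p.2)) → x ∈ S i → y ∈ S i) :
    eulerSign R = ∑ i ∈ I, eulerSign (R ∩ S i) := by
  induction L generalizing R with
  | nil =>
    rcases R.eq_empty_or_nonempty with rfl | ⟨x, hx⟩
    · simp [eulerSign_empty]
    · obtain ⟨i, hi, hxi⟩ := hcover x hx
      rw [Finset.sum_eq_single_of_mem i hi]
      · rw [Set.inter_eq_left.2 fun y hy => hsign i hi x hx y hy (by simp) hxi]
      · intro j hj hji
        rw [Set.eq_empty_of_forall_notMem (s := R ∩ S j), eulerSign_empty]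
        rintro y ⟨hy, hyj⟩
        exact hji (hdisj x hx j hj i hi (hsign j hj y hy x hx (by simp) hyj) hxi)
  | cons p L ih =>
    have step : ∀ T : Set V, IsRelOpen T →
        (∀ x ∈ T, ∀ y ∈ T, SignType.sign (p.1 x - p.2) = SignType.sign (p.1 y - p.2)) →
        eulerSign (R ∩ T) = ∑ i ∈ I, eulerSign (R ∩ S i ∩ T) := by
      intro T hT hTs
      rw [ih (R ∩ T) (hR.inter hT) (fun x hx => hcover x hx.1) (fun x hx => hdisj x hx.1)]
      · simp only [Set.inter_right_comm]
      · intro i hi x hx y hy h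
        refine hsign i hi x hx.1 y hy.1 ?_
        exact List.forall_mem_cons.2 ⟨hTs x hx.2 y hy.2, h⟩
    rw [eulerSign_cut hR p.1 p.2, step _ (isRelOpen_setOf_lt p.1 p.2),
      step _ (isRelOpen_setOf_eq p.1 p.2), step _ (isRelOpen_setOf_gt p.1 p.2),
      ← Finset.sum_add_distrib, ← Finset.sum_add_distrib]
    · exact Finset.sum_congr rfl fun i hi => (eulerSign_cut (hR.inter (hS i hi)) p.1 p.2).symm
    · intro x hx y hy
      rw [sign_neg (sub_neg.2 hx), sign_neg (sub_neg.2 hy)]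
    · intro x hx y hy
      rw [sub_eq_zero.2 hx, sub_eq_zero.2 hy]
    · intro x hx y hy
      rw [sign_pos (sub_pos.2 hx), sign_pos (sub_pos.2 hy)]

theorem combo_mem_algRelInterior {P : Set V} (hP : Convex ℝ P) {x y : V}
    (hx : x ∈ algRelInterior P) (hy : y ∈ P) {a b : ℝ} (ha : 0 < a) (hb : 0 ≤ b)
    (hab : a + b = 1) : a • x + b • y ∈ algRelInterior P := by
  refine ⟨hP hx.1 hy ha.le hb hab, fun w hw => ?_⟩
  obtain ⟨ε, hε, h⟩ := hx.2 w hw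
  have hD : 0 < 1 + b * ε := by positivity
  refine ⟨ε * a / (1 + b * ε), by positivity, ?_⟩
  obtain rfl : a = 1 - b := by linarith
  convert hP h hy (a := (1 - b) / (1 + b * ε)) (b := b * (1 + ε) / (1 + b * ε)) (by positivity)
    (by positivity) (by field_simp; ring) using 1
  match_scalars <;> field_simp <;> ring

theorem isRelOpen_algRelInterior {P : Set V} (hP : Convex ℝ P) :
    IsRelOpen (algRelInterior P) := by
  constructor
  · intro x hx y hy a b ha hb hab
    rcases ha.eq_or_lt with rfl | ha
    · obtain rfl : b = 1 := by linarith
      simpa using hy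
    · exact combo_mem_algRelInterior hP hx hy.1 ha hb hab
  · intro x hx y hy
    obtain ⟨ε, hε, h⟩ := hx.2 y hy.1
    refine ⟨ε / 2, by positivity, ?_⟩
    convert combo_mem_algRelInterior hP hx h (a := 1 / 2) (b := 1 / 2) (by norm_num) (by norm_num)
      (by norm_num) using 1
    module

theorem eulerSign_algRelInterior {P : Set V} (hP : Convex ℝ P) (hne : (algRelInterior P).Nonempty) :
    eulerSign (algRelInterior P) = (-1) ^ finrank ℝ (vectorSpan ℝ P) := by
  rw [eulerSign_of_nonempty hne]
  obtain ⟨x, hx⟩ := hne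
  rw [vectorSpan_eq_of_forall_exists_smul (fun y hy => hy.1) hx fun y hy =>
    ⟨1 / 2, by norm_num, ?_⟩]
  convert combo_mem_algRelInterior hP hx hy (a := 1 / 2) (b := 1 / 2) (by norm_num) (by norm_num)
    (by norm_num) using 1
  module

section Polyhedron

variable {ι : Type*} {f : ι → V →ₗ[ℝ] ℝ} {c : ι → ℝ}

theorem convex_polyhedron (f : ι → V →ₗ[ℝ] ℝ) (c : ι → ℝ) : Convex ℝ {x | ∀ i, c i ≤ f i x} := by
  rw [Set.ofPred_forall]
  exact convex_iInter fun i => convex_halfSpace_ge (f i).isLinear (c i)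

theorem exists_pos_forall_le [Finite ι] {x y : V} (hx : ∀ i, c i ≤ f i x)
    (hy : ∀ i, f i x = c i → f i y ≤ c i) :
    ∃ ε : ℝ, 0 < ε ∧ ∀ i, c i ≤ f i (x + ε • (x - y)) := by
  have hev : ∀ᶠ ε : ℝ in 𝓝[>] 0, ∀ i, c i ≤ f i (x + ε • (x - y)) := by
    refine eventually_all.2 fun i => ?_
    simp only [map_add, map_smul, map_sub, smul_eq_mul]
    rcases (hx i).eq_or_lt with h | h
    · filter_upwards [self_mem_nhdsWithin] with ε hε
      have := mul_nonneg (le_of_lt hε) (sub_nonneg.2 (hy i h.symm))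
      rw [← h]
      linarith
    · have hc : Continuous fun ε : ℝ => f i x + ε * (f i x - f i y) := by fun_prop
      have := hc.continuousAt (x := 0) |>.eventually_const_lt (u := c i) (by simpa using h)
      exact (this.filter_mono nhdsWithin_le_nhds).mono fun ε hε => hε.le
  obtain ⟨ε, h, hε⟩ := (hev.and self_mem_nhdsWithin).exists
  exact ⟨ε, hε, h⟩

theorem eq_of_mem_algRelInterior {x : V} (hx : x ∈ algRelInterior {x | ∀ i, c i ≤ f i x}) {i : ι}
    (hi : f i x = c i) {y : V} (hy : ∀ i, c i ≤ f i y) : f i y = c i := by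
  obtain ⟨ε, hε, h⟩ := hx.2 y hy
  have := h i
  simp only [map_add, map_smul, map_sub, smul_eq_mul] at this
  nlinarith [hy i]

theorem mem_algRelInterior_polyhedron [Finite ι] {x : V} :
    x ∈ algRelInterior {x | ∀ i, c i ≤ f i x} ↔
      (∀ i, c i ≤ f i x) ∧ ∀ i, f i x = c i → ∀ y, (∀ i, c i ≤ f i y) → f i y = c i :=
  ⟨fun h => ⟨h.1, fun _ hi _ hy => eq_of_mem_algRelInterior h hi hy⟩,
    fun h => ⟨h.1, fun y hy => exists_pos_forall_le h.1 fun i hi => (h.2 i hi y hy).le⟩⟩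

theorem algRelInterior_polyhedron_nonempty [Finite ι] (h : {x | ∀ i, c i ≤ f i x}.Nonempty) :
    (algRelInterior {x | ∀ i, c i ≤ f i x}).Nonempty := by
  obtain ⟨x, hx, hmin⟩ := exists_minimalFor_of_wellFoundedLT (fun x => ∀ i, c i ≤ f i x)
    (fun x => {i | f i x = c i}.ncard) h
  refine ⟨x, mem_algRelInterior_polyhedron.2 ⟨hx, fun i hi y hy => ?_⟩⟩
  by_contra hne
  have hz : ∀ j, f j ((1 / 2 : ℝ) • x + (1 / 2 : ℝ) • y) = (f j x + f j y) / 2 := fun j => by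
    simp only [map_add, map_smul, smul_eq_mul]
    ring
  have hlt : {j | f j ((1 / 2 : ℝ) • x + (1 / 2 : ℝ) • y) = c j}.ncard <
      {j | f j x = c j}.ncard := by
    refine Set.ncard_lt_ncard (Set.ssubset_iff_of_subset ?_ |>.2 ⟨i, hi, ?_⟩)
    · intro j hj
      rw [Set.mem_ofPred_eq, hz] at hj
      have h1 := hx j
      have h2 := hy j
      exact le_antisymm (by linarith) h1
    · rw [Set.mem_ofPred_eq, hz, hi]
      exact fun h => hne (by linarith)
  refine hlt.not_ge (hmin (fun j => ?_) hlt.le)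
  rw [hz]
  linarith [hx j, hy j]

theorem mem_algRelInterior_face [Finite ι] {x : V} (hx : ∀ i, c i ≤ f i x) {s : Set ι}
    (hs : ∀ i, i ∈ s ↔ f i x = c i) :
    x ∈ algRelInterior {y | (∀ i, c i ≤ f i y) ∧ ∀ i ∈ s, f i y = c i} := by
  refine ⟨⟨hx, fun i hi => (hs i).1 hi⟩, fun y hy => ?_⟩
  obtain ⟨ε, hε, h⟩ := exists_pos_forall_le hx fun i hi => (hy.2 i ((hs i).2 hi)).le
  refine ⟨ε, hε, h, fun i hi => ?_⟩
  simp [(hs i).1 hi, hy.2 i hi]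

end Polyhedron

end EulerPolyhedral


open scoped Classical

/-- **Euler identity.** Let `𝔓` be a polyhedral subdivision of a
finite-dimensional real vector space `V`: a finite collection of (nonempty) convex polyhedra
whose union is `V`, closed under taking closed faces, and such that the intersection of any
two members is a common face.  Then `∑_{P ∈ 𝔓} (−1)^{codim P} = 1`. -/
theorem euler_identity_polyhedral_subdivision
    (V : Type*) [AddCommGroup V] [Module ℝ V] [FiniteDimensional ℝ V]
    (𝔓 : Finset (Set V))
    (hpoly : ∀ P ∈ 𝔓, ∃ (m : ℕ) (f : Fin m → V →ₗ[ℝ] ℝ) (c : Fin m → ℝ),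
        P = {x | ∀ i, c i ≤ f i x})
    (hne : ∀ P ∈ 𝔓, P.Nonempty)
    (hcover : ∀ x : V, ∃ P ∈ 𝔓, x ∈ P)
    (hfaces : ∀ P ∈ 𝔓, ∀ (m : ℕ) (f : Fin m → V →ₗ[ℝ] ℝ) (c : Fin m → ℝ)
        (s : Finset (Fin m)), P = {x | ∀ i, c i ≤ f i x} →
        ({x : V | (∀ i, c i ≤ f i x) ∧ ∀ i ∈ s, f i x = c i}).Nonempty →
        {x : V | (∀ i, c i ≤ f i x) ∧ ∀ i ∈ s, f i x = c i} ∈ 𝔓)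
    (hint : ∀ P ∈ 𝔓, ∀ Q ∈ 𝔓, (P ∩ Q : Set V).Nonempty →
        ∃ (m : ℕ) (f : Fin m → V →ₗ[ℝ] ℝ) (c : Fin m → ℝ) (s : Finset (Fin m)),
          P = {x | ∀ i, c i ≤ f i x} ∧
          P ∩ Q = {x : V | (∀ i, c i ≤ f i x) ∧ ∀ i ∈ s, f i x = c i}) :
    (∑ P ∈ 𝔓, (-1 : ℤ) ^
        (Module.finrank ℝ V - Module.finrank ℝ ↥((affineSpan ℝ P).direction))) = 1 := by
  have hconv : ∀ P ∈ 𝔓, Convex ℝ P := fun P hP => by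
    obtain ⟨m, f, c, rfl⟩ := hpoly P hP
    exact convex_polyhedron f c
  have hri : ∀ P ∈ 𝔓, (algRelInterior P).Nonempty := fun P hP => by
    have := hne P hP
    obtain ⟨m, f, c, rfl⟩ := hpoly P hP
    exact algRelInterior_polyhedron_nonempty this
  have hsub : ∀ x, ∀ P ∈ 𝔓, ∀ Q ∈ 𝔓, x ∈ algRelInterior P → x ∈ algRelInterior Q → P ⊆ Q := by
    intro x P hP Q hQ hxP hxQ y hy
    obtain ⟨m, f, c, s, rfl, hPQ⟩ := hint P hP Q hQ ⟨x, hxP.1, hxQ.1⟩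
    have hx : x ∈ {x : V | (∀ i, c i ≤ f i x) ∧ ∀ i ∈ s, f i x = c i} := hPQ ▸ ⟨hxP.1, hxQ.1⟩
    have hyPQ : y ∈ {x : V | (∀ i, c i ≤ f i x) ∧ ∀ i ∈ s, f i x = c i} :=
      ⟨hy, fun i hi => eq_of_mem_algRelInterior hxP (hx.2 i hi) hy⟩
    rw [← hPQ] at hyPQ
    exact hyPQ.2
  choose! m f c hdesc using hpoly
  have hsum := eulerSign_eq_sum_of_partition 𝔓 algRelInterior
    (fun P hP => isRelOpen_algRelInterior (hconv P hP))
    (𝔓.toList.flatMap fun P => List.ofFn fun i => (f P i, c P i)) Set.univ isRelOpen_univ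
    (fun x _ => by
      obtain ⟨P, hP, hx⟩ := hcover x
      rw [hdesc P hP] at hx
      have hmem := mem_algRelInterior_face hx
        (s := (Finset.univ.filter fun i => f P i x = c P i : Finset (Fin (m P)))) (by simp)
      exact ⟨_, hfaces P hP _ _ _ _ (hdesc P hP) ⟨x, hmem.1⟩, hmem⟩)
    (fun x _ P hP Q hQ hxP hxQ =>
      (hsub x P hP Q hQ hxP hxQ).antisymm (hsub x Q hQ P hP hxQ hxP))
    (fun P hP x _ y _ hs hx => by
      have hs' : ∀ i, SignType.sign (f P i x - c P i) = SignType.sign (f P i y - c P i) :=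
        fun i => hs (f P i, c P i) (List.mem_flatMap.2
          ⟨P, Finset.mem_toList.2 hP, List.mem_ofFn.2 ⟨i, rfl⟩⟩)
      rw [hdesc P hP, mem_algRelInterior_polyhedron] at hx ⊢
      refine ⟨fun i => ?_, fun i hi => hx.2 i ?_⟩
      · have h := sub_nonneg.2 (hx.1 i)
        rwa [← sign_nonneg_iff, hs' i, sign_nonneg_iff, sub_nonneg] at h
      · rwa [← sub_eq_zero, ← sign_eq_zero_iff, hs' i, sign_eq_zero_iff, sub_eq_zero])
  have huniv : eulerSign (Set.univ : Set V) = (-1) ^ finrank ℝ V := by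
    rw [eulerSign_of_nonempty Set.univ_nonempty, ← direction_affineSpan, AffineSubspace.span_univ,
      AffineSubspace.direction_top, finrank_top]
  calc ∑ P ∈ 𝔓, (-1 : ℤ) ^ (finrank ℝ V - finrank ℝ ↥((affineSpan ℝ P).direction))
      = ∑ P ∈ 𝔓, (-1) ^ finrank ℝ V * eulerSign (Set.univ ∩ algRelInterior P) := by
        refine Finset.sum_congr rfl fun P hP => ?_
        rw [Set.univ_inter, eulerSign_algRelInterior (hconv P hP) (hri P hP), direction_affineSpan,
          ← pow_add, neg_one_pow_congr]
        have := Submodule.finrank_le (vectorSpan ℝ P)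
        rw [Nat.even_sub this, Nat.even_add]
    _ = 1 := by
        rw [← Finset.mul_sum, ← hsum, huniv, ← mul_pow]
        simp
end

section
/- Let P ⊂ ℝ^k be a nonempty compact k-dimensional rational convex polytope and for m ∈ ℕ let p(m) = #(ℤ^k ∩ mP) be the number of lattice points in the m-th dilate. Then p is a quasi-polynomial in m, whose period divides the smallest positive integer l such that lP is a lattice polytope. -/
open scoped Classical Pointwise

/-- The `l`-periodic quasi-polynomial functions `ℕ → ℚ`. -/
def quasiPolynomials (l : ℕ) : Submodule ℚ (ℕ → ℚ) where
  carrier := {f | ∃ q : ℕ → Polynomial ℚ, ∀ m : ℕ, f m = (q (m % l)).eval (m : ℚ)}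
  add_mem' := by
    rintro f g ⟨p, hp⟩ ⟨q, hq⟩
    exact ⟨fun r => p r + q r, fun m => by simp [hp, hq]⟩
  zero_mem' := ⟨fun _ => 0, fun m => by simp⟩
  smul_mem' := by
    rintro a f ⟨p, hp⟩
    exact ⟨fun r => Polynomial.C a * p r, fun m => by simp [hp]⟩

/-- The function counting the tuples in `ℕ^d` whose sum `s` satisfies `h + l * s = m` is
quasi-polynomial on all of `ℕ`, provided the shift `h` is less than `l * d`. -/
theorem mem_quasiPolynomials_of_choose {l d h : ℕ} (hl : 0 < l) (hd : 0 < d) (hh : h < l * d)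
    {f : ℕ → ℚ} (hf : ∀ s : ℕ, f (h + l * s) = ((d + s - 1).choose s : ℕ))
    (hf0 : ∀ m, (∀ s : ℕ, m ≠ h + l * s) → f m = 0) : f ∈ quasiPolynomials l := by
  obtain ⟨e, rfl⟩ : ∃ e, d = e + 1 := ⟨d - 1, by omega⟩
  have hl' : (l : ℚ) ≠ 0 := by exact_mod_cast hl.ne'
  let g : Polynomial ℚ := Polynomial.C (1 / (e.factorial : ℚ)) * (descPochhammer ℚ e).comp
    (Polynomial.C (1 / (l : ℚ)) * (Polynomial.X - Polynomial.C (h : ℚ)) + Polynomial.C (e : ℚ))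
  have key : ∀ (m N : ℕ), (m : ℚ) - h = l * ((N : ℚ) - e) →
      g.eval (m : ℚ) = (N.choose e : ℕ) := by
    intro m N hN
    have : 1 / (l : ℚ) * ((m : ℚ) - h) + e = N := by
      rw [hN]; field_simp; ring
    simp only [g, Polynomial.eval_mul, Polynomial.eval_C, Polynomial.eval_comp,
      Polynomial.eval_add, Polynomial.eval_sub, Polynomial.eval_X, this]
    rw [Nat.cast_choose_eq_descPochhammer_div]
    ring
  refine ⟨fun r => if r = h % l then g else 0, fun m => ?_⟩
  by_cases hm : m % l = h % l
  · simp only [hm, if_true]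
    rcases le_or_gt h m with hle | hlt
    · obtain ⟨s, hs⟩ : l ∣ m - h := (Nat.modEq_iff_dvd' hle).1 hm.symm
      obtain rfl : m = h + l * s := by omega
      rw [hf, key _ (e + s) (by push_cast; ring), show e + 1 + s - 1 = e + s by omega,
        Nat.choose_symm_add]
    · obtain ⟨j, hj⟩ : l ∣ h - m := (Nat.modEq_iff_dvd' hlt.le).1 hm
      have hj0 : 0 < j := Nat.pos_of_ne_zero (by rintro rfl; omega)
      have hje : j ≤ e := by
        have : l * j < l * (e + 1) := by omega
        have := Nat.lt_of_mul_lt_mul_left this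
        omega
      have hhm : (h : ℚ) = m + l * j := by
        have : h = m + l * j := by omega
        exact_mod_cast this
      rw [hf0 m (fun s hs => by omega), key m (e - j) (by rw [hhm, Nat.cast_sub hje]; ring),
        Nat.choose_eq_zero_of_lt (by omega), Nat.cast_zero]
  · simp only [if_neg hm, Polynomial.eval_zero]
    refine hf0 m fun s hs => hm ?_
    rw [hs, Nat.add_mul_mod_self_left]

section Weights

variable {ι : Type*} [Fintype ι] {k : ℕ}

/-- Barycentric weights on the points `w i`, of total mass `m / l`, whose weighted sum is a
lattice point. -/
def latticeWeights (l : ℕ) (w : ι → Fin k → ℤ) (m : ℕ) : Set (ι → ℝ) :=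
  {c | (∀ i, 0 ≤ c i) ∧ (l : ℝ) * ∑ i, c i = m ∧
    ∀ j, ∃ z : ℤ, ∑ i, c i * (w i j : ℝ) = z}

/-- Affine dependences: weights of total mass zero and weighted sum zero. -/
def affineRelations (w : ι → Fin k → ℤ) : Submodule ℝ (ι → ℝ) where
  carrier := {d | ∑ i, d i = 0 ∧ ∀ j, ∑ i, d i * (w i j : ℝ) = 0}
  add_mem' := by
    rintro a b ⟨ha, ha'⟩ ⟨hb, hb'⟩
    exact ⟨by simp [Finset.sum_add_distrib, ha, hb],
      fun j => by simp [add_mul, Finset.sum_add_distrib, ha', hb']⟩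
  zero_mem' := by simp
  smul_mem' := by
    rintro a b ⟨hb, hb'⟩
    exact ⟨by simp [← Finset.mul_sum, hb],
      fun j => by simp [mul_assoc, ← Finset.mul_sum, hb']⟩

/-- The points `w i` with `i ∈ σ` satisfy no nontrivial affine relation. -/
def AffineIndependentOn (w : ι → Fin k → ℤ) (σ : Finset ι) : Prop :=
  ∀ d ∈ affineRelations w, (∀ i ∉ σ, d i = 0) → d = 0

theorem AffineIndependentOn.mono {w : ι → Fin k → ℤ} {σ τ : Finset ι}
    (h : AffineIndependentOn w σ) (hτ : τ ⊆ σ) : AffineIndependentOn w τ :=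
  fun d hd h0 => h d hd fun i hi => h0 i fun hi' => hi (hτ hi')

theorem finite_abs_le_intCast (M : ℝ) : {x : ℝ | |x| ≤ M ∧ ∃ z : ℤ, x = z}.Finite := by
  refine ((Set.finite_Icc (-⌈M⌉) ⌈M⌉).image (fun z : ℤ => (z : ℝ))).subset ?_
  rintro _ ⟨hx, z, rfl⟩
  refine ⟨z, ?_, rfl⟩
  rw [Set.mem_Icc, ← abs_le]
  exact_mod_cast hx.trans (Int.le_ceil M)

theorem AffineIndependentOn.finite_bounded {l : ℕ} (hl : 0 < l) {w : ι → Fin k → ℤ}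
    {σ : Finset ι} (hσ : AffineIndependentOn w σ) (B : ℝ) :
    {c : ι → ℝ | (∀ i ∉ σ, c i = 0) ∧ (∀ i, c i ≤ B) ∧ ∃ m, c ∈ latticeWeights l w m}.Finite := by
  let g : (ι → ℝ) → ℝ × (Fin k → ℝ) := fun c => (l * ∑ i, c i, fun j => ∑ i, c i * (w i j : ℝ))
  refine Set.Finite.of_finite_image (f := g) (((finite_abs_le_intCast (l * ∑ _i : ι, B)).prod
    (Set.Finite.pi (ι := Fin k) fun j =>
      finite_abs_le_intCast (∑ i, B * |(w i j : ℝ)|))).subset ?_) ?_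
  · rintro _ ⟨c, ⟨-, hB, m, h0, hm, hz⟩, rfl⟩
    refine ⟨⟨?_, m, by simpa [g] using hm⟩, fun j _ => ⟨?_, hz j⟩⟩
    · simp only [g]
      rw [abs_of_nonneg (mul_nonneg (Nat.cast_nonneg _) (Finset.sum_nonneg fun i _ => h0 i))]
      gcongr with i
      exact hB i
    · refine (Finset.abs_sum_le_sum_abs _ _).trans (Finset.sum_le_sum fun i _ => ?_)
      rw [abs_mul, abs_of_nonneg (h0 i)]
      gcongr
      exact hB i
  · rintro c ⟨hc, -⟩ c' ⟨hc', -⟩ h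
    simp only [g, Prod.mk.injEq, funext_iff] at h
    have hl' : (l : ℝ) ≠ 0 := by exact_mod_cast hl.ne'
    have h1 := mul_left_cancel₀ hl' h.1
    refine sub_eq_zero.1 (hσ (c - c') ⟨by simp [h1], fun j => ?_⟩ fun i hi => ?_)
    · simp [sub_mul, h.2 j]
    · simp [hc i hi, hc' i hi]

/-- The lattice weights supported in `σ`. -/
def closedWeights (l : ℕ) (w : ι → Fin k → ℤ) (σ : Finset ι) (m : ℕ) : Set (ι → ℝ) :=
  {c ∈ latticeWeights l w m | ∀ i ∉ σ, c i = 0}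

theorem AffineIndependentOn.finite_closedWeights {l : ℕ} (hl : 0 < l) {w : ι → Fin k → ℤ}
    {σ : Finset ι} (hσ : AffineIndependentOn w σ) (m : ℕ) :
    (closedWeights l w σ m).Finite := by
  refine (hσ.finite_bounded hl m).subset ?_
  rintro c ⟨hc, h0⟩
  refine ⟨h0, fun i => ?_, m, hc⟩
  calc c i ≤ ∑ i, c i := Finset.single_le_sum (fun i _ => hc.1 i) (Finset.mem_univ i)
    _ ≤ l * ∑ i, c i := le_mul_of_one_le_left (Finset.sum_nonneg fun i _ => hc.1 i)
        (by exact_mod_cast hl)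
    _ = m := hc.2.1

theorem ncard_closedWeights_mem {l : ℕ} (hl : 0 < l) {w : ι → Fin k → ℤ}
    {σ : Finset ι} (hσ : AffineIndependentOn w σ) (hne : σ.Nonempty) :
    (fun m => ((closedWeights l w σ m).ncard : ℚ)) ∈ quasiPolynomials l := by
  classical
  let F : Set (ι → ℝ) := {f | (∀ i ∉ σ, f i = 0) ∧ (∀ i, f i < 1) ∧ ∃ m, f ∈ latticeWeights l w m}
  have hF : F.Finite := (hσ.finite_bounded hl 1).subset fun f hf =>
    ⟨hf.1, fun i => (hf.2.1 i).le, hf.2.2⟩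
  let φ : (ι → ℝ) → (ι → ℝ) := fun c i => Int.fract (c i)
  -- splitting off integer parts preserves the lattice conditions
  have hsplit : ∀ (f : ι → ℝ) (a : ι → ℕ) (j : Fin k),
      ∑ i, (f i + a i) * (w i j : ℝ) = ∑ i, f i * (w i j : ℝ) + ((∑ i, a i * w i j : ℤ) : ℝ) := by
    intro f a j
    push_cast
    rw [← Finset.sum_add_distrib]
    exact Finset.sum_congr rfl fun i _ => by ring
  have hfloor : ∀ c : ι → ℝ, (∀ i, 0 ≤ c i) → c = fun i => φ c i + (⌊c i⌋₊ : ℝ) := by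
    intro c hc
    funext i
    rw [natCast_floor_eq_intCast_floor (hc i)]
    exact (Int.fract_add_floor _).symm
  have hmaps : ∀ m, ∀ c ∈ closedWeights l w σ m, φ c ∈ F := by
    rintro m c ⟨⟨h0, hm, hz⟩, hs⟩
    refine ⟨fun i hi => by simp [φ, hs i hi], fun i => Int.fract_lt_one _, ?_⟩
    have hc := hfloor c h0
    have hle : l * ∑ i, ⌊c i⌋₊ ≤ m := by
      have : (l : ℝ) * ∑ i, (⌊c i⌋₊ : ℝ) ≤ m := by
        rw [← hm]
        gcongr with i
        exact Nat.floor_le (h0 i)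
      exact_mod_cast this
    refine ⟨m - l * ∑ i, ⌊c i⌋₊, fun i => Int.fract_nonneg _, ?_, fun j => ?_⟩
    · have hadd : ∑ i, c i = ∑ i, φ c i + ∑ i, (⌊c i⌋₊ : ℝ) := by
        rw [← Finset.sum_add_distrib]
        exact Finset.sum_congr rfl fun i _ => congrFun hc i
      rw [Nat.cast_sub hle, ← hm, hadd]
      push_cast
      ring
    · obtain ⟨z, hz⟩ := hz j
      rw [hc, hsplit] at hz
      exact ⟨z - ∑ i, ⌊c i⌋₊ * w i j, by rw [Int.cast_sub, ← hz]; ring⟩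
  have hsum : (fun m => ((closedWeights l w σ m).ncard : ℚ)) =
      ∑ f ∈ hF.toFinset, fun m => (({c ∈ closedWeights l w σ m | φ c = f}.ncard : ℕ) : ℚ) := by
    funext m
    have hfin := hσ.finite_closedWeights hl m
    rw [Finset.sum_apply, Set.ncard_eq_toFinset_card _ hfin,
      Finset.card_eq_sum_card_fiberwise (f := φ) (t := hF.toFinset)
        (fun c hc => by simpa using hmaps m c (by simpa using hc)), Nat.cast_sum]
    refine Finset.sum_congr rfl fun f _ => ?_
    rw [← Set.ncard_coe_finset]
    congr 2
    ext c
    simp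
  rw [hsum]
  refine Submodule.sum_mem _ fun f hf => ?_
  obtain ⟨hfs, hf1, h, hf0, hfh, hfz⟩ := hF.mem_toFinset.1 hf
  have hfr : ∀ a : ι → ℕ, φ (fun i => f i + a i) = f := fun a => by
    funext i
    simp only [φ, Int.fract_add_natCast]
    exact Int.fract_eq_self.2 ⟨hf0 i, hf1 i⟩
  have hmem : ∀ c : ι → ℝ, (∀ i, 0 ≤ c i) → φ c = f → c = fun i => f i + (⌊c i⌋₊ : ℝ) := by
    rintro c hc rfl
    exact hfloor c hc
  have hmass : ∀ a : ι → ℕ, (l : ℝ) * ∑ i, (f i + a i) = ((h + l * ∑ i, a i : ℕ) : ℝ) := by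
    intro a
    rw [Finset.sum_add_distrib, mul_add, hfh]
    push_cast
    rfl
  refine mem_quasiPolynomials_of_choose (d := σ.card) (h := h) hl hne.card_pos ?_ ?_ ?_
  · have : (h : ℝ) < l * σ.card := by
      rw [← hfh]
      have hl' : (0 : ℝ) < l := by exact_mod_cast hl
      gcongr
      rw [← Finset.sum_subset (Finset.subset_univ σ) fun i _ hi => hfs i hi]
      simpa using Finset.sum_lt_sum_of_nonempty hne fun i _ => hf1 i
    exact_mod_cast this
  · intro s
    have hcard : (σ.piAntidiag s).card = (σ.card + s - 1).choose s := by
      rw [← Finset.card_finsuppAntidiag_nat_eq_choose]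
      simp [Finset.finsuppAntidiag]
    rw [← hcard, ← Set.ncard_coe_finset]
    congr 1
    symm
    refine Set.ncard_congr (fun a _ => fun i => f i + (a i : ℝ)) ?_ ?_ ?_
    · intro a ha
      simp only [Finset.mem_coe, Finset.mem_piAntidiag] at ha
      obtain ⟨rfl, ha⟩ := ha
      have ha' : ∀ i ∉ σ, a i = 0 := fun i hi => by_contra fun h => hi (ha i h)
      refine ⟨⟨⟨fun i => add_nonneg (hf0 i) (Nat.cast_nonneg _), ?_, fun j => ?_⟩, fun i hi => ?_⟩,
        hfr a⟩
      · rw [hmass, Finset.sum_subset (Finset.subset_univ σ) fun i _ hi => ha' i hi]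
      · obtain ⟨z, hz⟩ := hfz j
        exact ⟨z + ∑ i, a i * w i j, by rw [hsplit, hz, Int.cast_add]⟩
      · simp [hfs i hi, ha' i hi]
    · intro a b _ _ hab
      funext i
      simpa using congrFun hab i
    · rintro c ⟨⟨⟨hc0, hcm, -⟩, hcs⟩, hcf⟩
      refine ⟨fun i => ⌊c i⌋₊, ?_, (hmem c hc0 hcf).symm⟩
      have hs0 : ∀ i ∉ σ, ⌊c i⌋₊ = 0 := fun i hi => by simp [hcs i hi]
      rw [Finset.mem_coe, Finset.mem_piAntidiag]
      refine ⟨?_, fun i hi => by_contra fun h => hi (hs0 i h)⟩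
      rw [Finset.sum_subset (Finset.subset_univ σ) fun i _ hi => hs0 i hi]
      rw [hmem c hc0 hcf, hmass] at hcm
      have := Nat.add_left_cancel (Nat.cast_injective hcm)
      exact Nat.eq_of_mul_eq_mul_left hl this
  · intro m hm
    rw [Nat.cast_eq_zero]
    convert Set.ncard_empty (ι → ℝ)
    rw [Set.eq_empty_iff_forall_notMem]
    rintro c ⟨⟨⟨hc0, hcm, -⟩, hcs⟩, hcf⟩
    rw [hmem c hc0 hcf, hmass] at hcm
    exact hm _ (Nat.cast_injective hcm).symm

end Weights

section Triangulation

variable {n k : ℕ}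

/-- The lattice weights whose support together with the apex `0` is exactly `σ`. -/
def halfOpenWeights (l : ℕ) (w : Fin (n + 1) → Fin k → ℤ) (σ : Finset (Fin (n + 1))) (m : ℕ) :
    Set (Fin (n + 1) → ℝ) :=
  {c ∈ latticeWeights l w m | insert 0 (Finset.univ.filter (c · ≠ 0)) = σ}

theorem ncard_halfOpenWeights_mem {l : ℕ} (hl : 0 < l) {w : Fin (n + 1) → Fin k → ℤ}
    (σ : Finset (Fin (n + 1))) (hσ : AffineIndependentOn w σ) :
    (fun m => ((halfOpenWeights l w σ m).ncard : ℚ)) ∈ quasiPolynomials l := by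
  induction σ using Finset.strongInduction with
  | H σ ih =>
  by_cases h0 : 0 ∈ σ
  · have hsum : (fun m => ((closedWeights l w σ m).ncard : ℚ)) =
        ∑ ρ ∈ σ.powerset, fun m => ((halfOpenWeights l w ρ m).ncard : ℚ) := by
      funext m
      have hsupp : ∀ c : Fin (n + 1) → ℝ, (∀ i ∉ σ, c i = 0) →
          insert 0 (Finset.univ.filter (c · ≠ 0)) ⊆ σ := by
        intro c hc
        refine Finset.insert_subset h0 fun i hi => ?_
        by_contra h
        exact (Finset.mem_filter.1 hi).2 (hc i h)
      have hfin := hσ.finite_closedWeights hl m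
      rw [Finset.sum_apply, Set.ncard_eq_toFinset_card _ hfin,
        Finset.card_eq_sum_card_fiberwise
          (f := fun c : Fin (n + 1) → ℝ => insert 0 (Finset.univ.filter (c · ≠ 0)))
          (t := σ.powerset)
          (fun c hc => by
            simpa only [Finset.coe_powerset, Set.mem_preimage, Set.mem_powerset_iff,
              Finset.coe_subset] using hsupp c (hfin.mem_toFinset.1 hc).2), Nat.cast_sum]
      refine Finset.sum_congr rfl fun ρ hρ => ?_
      rw [← Set.ncard_coe_finset]
      congr 2
      ext c
      simp only [Finset.coe_filter, Set.Finite.mem_toFinset, halfOpenWeights, Set.mem_ofPred_eq,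
        closedWeights]
      refine ⟨fun h => ⟨h.1.1, h.2⟩, fun h => ⟨⟨h.1, fun i hi => ?_⟩, h.2⟩⟩
      by_contra hci
      refine hi (Finset.mem_powerset.1 hρ ?_)
      rw [← h.2]
      exact Finset.mem_insert_of_mem (by simpa using hci)
    rw [← Finset.insert_erase (Finset.mem_powerset_self σ),
      Finset.sum_insert (Finset.notMem_erase _ _)] at hsum
    rw [← sub_eq_iff_eq_add] at hsum
    rw [← hsum]
    refine Submodule.sub_mem _ (ncard_closedWeights_mem hl hσ ⟨0, h0⟩)
      (Submodule.sum_mem _ fun ρ hρ => ?_)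
    have hρσ := Finset.mem_powerset.1 (Finset.mem_of_mem_erase hρ)
    exact ih ρ (hρσ.ssubset_of_ne (Finset.ne_of_mem_erase hρ)) (hσ.mono hρσ)
  · convert (quasiPolynomials l).zero_mem with m
    rw [Pi.zero_apply, Nat.cast_eq_zero]
    convert Set.ncard_empty (Fin (n + 1) → ℝ)
    rw [Set.eq_empty_iff_forall_notMem]
    rintro c ⟨-, rfl⟩
    exact h0 (Finset.mem_insert_self _ _)

/-- The first nonzero coordinate of `d` is positive. -/
def LexPos (d : Fin n → ℝ) : Prop := ∃ i, 0 < d i ∧ ∀ j < i, d j = 0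

theorem lexPos_or_lexPos_neg {d : Fin n → ℝ} (hd : d ≠ 0) : LexPos d ∨ LexPos (-d) := by
  have hex : ∃ i, d i ≠ 0 := Function.ne_iff.1 hd
  obtain ⟨i, hi, hmin⟩ := WellFounded.has_min (wellFounded_lt (α := Fin n)) {i | d i ≠ 0} hex
  have hmin' : ∀ j < i, d j = 0 := fun j hj => by_contra fun h => hmin j h hj
  rcases lt_or_gt_of_ne hi with h | h
  · exact Or.inr ⟨i, by simpa using h, fun j hj => by simp [hmin' j hj]⟩
  · exact Or.inl ⟨i, h, hmin'⟩

theorem IsCompact.exists_forall_not_lexPos_sub {K : Set (Fin n → ℝ)} (hK : IsCompact K)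
    (hne : K.Nonempty) : ∃ c ∈ K, ∀ c' ∈ K, ¬ LexPos (c' - c) := by
  have key : ∀ N ≤ n, ∃ c ∈ K, ∀ c' ∈ K,
      ¬ ∃ i : Fin n, (i : ℕ) < N ∧ 0 < (c' - c) i ∧ ∀ j < i, (c' - c) j = 0 := by
    intro N
    induction N with
    | zero =>
      obtain ⟨c, hc⟩ := hne
      exact fun _ => ⟨c, hc, by simp⟩
    | succ N ih =>
      intro hN
      obtain ⟨c, hc, hmax⟩ := ih (by omega)
      let i₀ : Fin n := ⟨N, by omega⟩
      have hclosed : IsClosed {c' : Fin n → ℝ | ∀ j < i₀, c' j = c j} := by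
        simp only [Set.ofPred_forall]
        exact isClosed_iInter fun j => isClosed_iInter fun _ =>
          isClosed_eq (continuous_apply j) continuous_const
      obtain ⟨c₁, ⟨hc₁, hag⟩, hc₁max⟩ := (hK.inter_right hclosed).exists_isMaxOn
        ⟨c, hc, fun _ _ => rfl⟩ (continuous_apply i₀).continuousOn
      refine ⟨c₁, hc₁, fun c' hc' ⟨i, hi, hpos, hz⟩ => ?_⟩
      rcases Nat.lt_succ_iff_lt_or_eq.1 hi with hlt | heq
      · refine hmax c' hc' ⟨i, hlt, ?_, fun j hj => ?_⟩
        · simpa [hag i hlt] using hpos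
        · simpa [hag j (hj.trans hlt)] using hz j hj
      · obtain rfl : i = i₀ := Fin.ext heq
        have : c' i₀ ≤ c₁ i₀ := hc₁max ⟨hc', fun j hj => by
          rw [← hag j hj, ← sub_eq_zero]
          exact hz j hj⟩
        simp only [Pi.sub_apply, sub_pos] at hpos
        exact this.not_gt hpos
  obtain ⟨c, hc, h⟩ := key n le_rfl
  exact ⟨c, hc, fun c' hc' ⟨i, hi⟩ => h c' hc' ⟨i, i.2, hi⟩⟩

/-- The faces of the pulling triangulation of the points `w i`: the sets `σ` such that no weights
supported in `σ` can be increased lexicographically along an affine relation. -/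
def IsPullingFace (w : Fin n → Fin k → ℤ) (σ : Finset (Fin n)) : Prop :=
  ∀ d ∈ affineRelations w, (∀ i ∉ σ, 0 ≤ d i) → ¬ LexPos d

theorem IsPullingFace.affineIndependentOn {w : Fin n → Fin k → ℤ} {σ : Finset (Fin n)}
    (h : IsPullingFace w σ) : AffineIndependentOn w σ := by
  intro d hd h0
  by_contra hne
  rcases lexPos_or_lexPos_neg hne with hp | hp
  · exact h d hd (fun i hi => (h0 i hi).ge) hp
  · exact h (-d) (Submodule.neg_mem _ hd) (fun i hi => by simp [h0 i hi]) hp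

theorem isPullingFace_insert_zero {w : Fin (n + 1) → Fin k → ℤ} {σ : Finset (Fin (n + 1))} :
    IsPullingFace w (insert 0 σ) ↔ IsPullingFace w σ := by
  refine ⟨fun h d hd h0 => h d hd fun i hi => h0 i fun hi' => hi (Finset.mem_insert_of_mem hi'),
    fun h d hd h0 hp => h d hd (fun i hi => ?_) hp⟩
  rcases eq_or_ne i 0 with rfl | hi0
  · obtain ⟨i, hi, hj⟩ := hp
    rcases eq_or_ne i 0 with rfl | hi0
    · exact hi.le
    · exact (hj 0 (Fin.pos_of_ne_zero hi0)).ge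
  · exact h0 i (by simp [hi0, hi])

theorem isPullingFace_support_iff {w : Fin n → Fin k → ℤ} {c : Fin n → ℝ} (hc : ∀ i, 0 ≤ c i) :
    IsPullingFace w (Finset.univ.filter (c · ≠ 0)) ↔
      ∀ c' : Fin n → ℝ, (∀ i, 0 ≤ c' i) → c' - c ∈ affineRelations w → ¬ LexPos (c' - c) := by
  constructor
  · intro h c' hc' hmem
    refine h _ hmem fun i hi => ?_
    have : c i = 0 := by simpa using hi
    simpa [this] using hc' i
  · intro h d hd h0 hp
    have hev : ∀ᶠ ε : ℝ in nhdsWithin 0 (Set.Ioi 0), ∀ i, 0 ≤ c i + ε * d i := by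
      refine Filter.eventually_all.2 fun i => ?_
      by_cases hci : c i = 0
      · filter_upwards [self_mem_nhdsWithin] with ε hε
        rw [hci, zero_add]
        exact mul_nonneg (le_of_lt hε) (h0 i (by simpa using hci))
      · have hpos : 0 < c i := lt_of_le_of_ne (hc i) (Ne.symm hci)
        have hcont : Continuous fun ε : ℝ => c i + ε * d i := by fun_prop
        have := hcont.tendsto 0
        rw [zero_mul, add_zero] at this
        exact nhdsWithin_le_nhds ((this.eventually (lt_mem_nhds hpos)).mono fun ε h => h.le)
    obtain ⟨ε, hε, hεpos⟩ := (hev.and self_mem_nhdsWithin).exists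
    have hsub : (c + ε • d) - c = ε • d := add_sub_cancel_left _ _
    refine h (c + ε • d) hε (by rw [hsub]; exact Submodule.smul_mem _ _ hd) ?_
    obtain ⟨i, hi, hj⟩ := hp
    rw [hsub]
    exact ⟨i, mul_pos hεpos hi, fun j hji => by simp [hj j hji]⟩

/-- The number of lattice points of the dilates of the polytope with vertices `w i / l` is
quasi-polynomial. -/
theorem ncard_sum_smul_mem {l : ℕ} (hl : 0 < l) (w : Fin (n + 1) → Fin k → ℤ) :
    (fun m : ℕ => ({x : Fin k → ℤ | ∃ c : Fin (n + 1) → ℝ, (∀ i, 0 ≤ c i) ∧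
      (l : ℝ) * ∑ i, c i = m ∧ ∀ j, ∑ i, c i * (w i j : ℝ) = x j}.ncard : ℚ))
      ∈ quasiPolynomials l := by
  have hl' : (l : ℝ) ≠ 0 := by exact_mod_cast hl.ne'
  let Δ : Finset (Finset (Fin (n + 1))) := Finset.univ.filter fun σ => IsPullingFace w σ
  suffices h : (fun m : ℕ => ({x : Fin k → ℤ | ∃ c : Fin (n + 1) → ℝ, (∀ i, 0 ≤ c i) ∧
      (l : ℝ) * ∑ i, c i = m ∧ ∀ j, ∑ i, c i * (w i j : ℝ) = x j}.ncard : ℚ)) =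
      ∑ σ ∈ Δ, fun m => ((halfOpenWeights l w σ m).ncard : ℚ) by
    rw [h]
    exact Submodule.sum_mem _ fun σ hσ =>
      ncard_halfOpenWeights_mem hl σ (Finset.mem_filter.1 hσ).2.affineIndependentOn
  funext m
  let A : Set (Fin (n + 1) → ℝ) :=
    {c ∈ latticeWeights l w m | IsPullingFace w (Finset.univ.filter (c · ≠ 0))}
  have hA : A.Finite := by
    refine (Set.Finite.biUnion Δ.finite_toSet fun σ hσ =>
      ((Finset.mem_filter.1 hσ).2.affineIndependentOn).finite_closedWeights hl m).subset ?_
    rintro c ⟨hc, hface⟩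
    simp only [Set.mem_iUnion]
    exact ⟨_, Finset.mem_filter.2 ⟨Finset.mem_univ _, hface⟩, hc, fun i hi => by simpa using hi⟩
  have hbij : {x : Fin k → ℤ | ∃ c : Fin (n + 1) → ℝ, (∀ i, 0 ≤ c i) ∧
      (l : ℝ) * ∑ i, c i = m ∧ ∀ j, ∑ i, c i * (w i j : ℝ) = x j}.ncard = A.ncard := by
    symm
    refine Set.ncard_congr (fun c hc j => (hc.1.2.2 j).choose) ?_ ?_ ?_
    · intro c hc
      exact ⟨c, hc.1.1, hc.1.2.1, fun j => (hc.1.2.2 j).choose_spec⟩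
    · intro c c' hc hc' h
      have hrel : c' - c ∈ affineRelations w := by
        refine ⟨?_, fun j => ?_⟩
        · have := mul_left_cancel₀ hl' (hc.1.2.1.trans hc'.1.2.1.symm)
          simp [this]
        · have := congrFun h j
          simp only [Pi.sub_apply, sub_mul, Finset.sum_sub_distrib]
          rw [(hc.1.2.2 j).choose_spec, (hc'.1.2.2 j).choose_spec, this, sub_self]
      by_contra hne
      rcases lexPos_or_lexPos_neg (sub_ne_zero.2 (Ne.symm hne)) with hp | hp
      · exact (isPullingFace_support_iff hc.1.1).1 hc.2 c' hc'.1.1 hrel hp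
      · rw [neg_sub] at hp
        exact (isPullingFace_support_iff hc'.1.1).1 hc'.2 c hc.1.1
          (by rw [← neg_sub]; exact Submodule.neg_mem _ hrel) hp
    · rintro x ⟨c, hc0, hcm, hcx⟩
      let K : Set (Fin (n + 1) → ℝ) := {c | (∀ i, 0 ≤ c i) ∧ (l : ℝ) * ∑ i, c i = m ∧
        ∀ j, ∑ i, c i * (w i j : ℝ) = x j}
      have hK : IsCompact K := by
        refine (isCompact_univ_pi fun _ => isCompact_Icc (a := (0 : ℝ)) (b := m)).of_isClosed_subset
          ?_ ?_
        · simp only [K, Set.ofPred_and, Set.ofPred_forall]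
          refine IsClosed.inter (isClosed_iInter fun i => isClosed_le continuous_const
            (continuous_apply i)) (IsClosed.inter (isClosed_eq (by fun_prop) continuous_const)
            (isClosed_iInter fun j => isClosed_eq (by fun_prop) continuous_const))
        · rintro c ⟨h0, hm, -⟩ i -
          refine ⟨h0 i, ?_⟩
          calc c i ≤ ∑ i, c i := Finset.single_le_sum (fun i _ => h0 i) (Finset.mem_univ i)
            _ ≤ l * ∑ i, c i := le_mul_of_one_le_left (Finset.sum_nonneg fun i _ => h0 i)
                (by exact_mod_cast hl)
            _ = m := hm
      obtain ⟨b, ⟨hb0, hbm, hbx⟩, hmax⟩ := hK.exists_forall_not_lexPos_sub ⟨c, hc0, hcm, hcx⟩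
      have hb : b ∈ A := by
        refine ⟨⟨hb0, hbm, fun j => ⟨x j, hbx j⟩⟩, (isPullingFace_support_iff hb0).2 ?_⟩
        rintro c' hc'0 ⟨hs, hw⟩
        simp only [Pi.sub_apply, Finset.sum_sub_distrib, sub_mul, sub_eq_zero] at hs hw
        exact hmax c' ⟨hc'0, by rw [hs, hbm], fun j => by rw [hw j, hbx j]⟩
      refine ⟨b, hb, funext fun j => ?_⟩
      have := (hbx j).symm.trans (hb.1.2.2 j).choose_spec
      exact_mod_cast this.symm
  rw [hbij, Finset.sum_apply, Set.ncard_eq_toFinset_card _ hA, Finset.card_eq_sum_card_fiberwise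
    (f := fun c : Fin (n + 1) → ℝ => insert 0 (Finset.univ.filter (c · ≠ 0))) (t := Δ)
    (fun c hc => Finset.mem_coe.2 (Finset.mem_filter.2 ⟨Finset.mem_univ _,
      isPullingFace_insert_zero.2 (hA.mem_toFinset.1 hc).2⟩)), Nat.cast_sum]
  refine Finset.sum_congr rfl fun σ hσ => ?_
  rw [← Set.ncard_coe_finset]
  congr 2
  ext c
  simp only [Finset.coe_filter, Set.Finite.mem_toFinset, halfOpenWeights, Set.mem_ofPred_eq, A]
  refine ⟨fun h => ⟨h.1.1, h.2⟩, fun h => ⟨⟨h.1, ?_⟩, h.2⟩⟩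
  rw [← isPullingFace_insert_zero, h.2]
  exact (Finset.mem_filter.1 hσ).2

end Triangulation

theorem mem_convexHull_range_iff {ι E : Type*} [Fintype ι] [AddCommGroup E] [Module ℝ E]
    {v : ι → E} {x : E} : x ∈ convexHull ℝ (Set.range v) ↔
      ∃ b : ι → ℝ, (∀ i, 0 ≤ b i) ∧ ∑ i, b i = 1 ∧ ∑ i, b i • v i = x := by
  classical
  rw [convexHull_range_eq_exists_affineCombination]
  constructor
  · rintro ⟨s, b, hb, hs, rfl⟩
    refine ⟨fun i => if i ∈ s then b i else 0, fun i => ?_, by simpa using hs, ?_⟩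
    · dsimp only
      split_ifs with h
      exacts [hb i h, le_rfl]
    · rw [s.affineCombination_eq_linear_combination v b hs]
      simp [ite_smul]
  · rintro ⟨b, hb, hs, rfl⟩
    exact ⟨Finset.univ, b, fun i _ => hb i, hs,
      Finset.univ.affineCombination_eq_linear_combination v b hs⟩

/-- **Ehrhart quasi-polynomiality.** Let `P ⊂ ℝ^k` be a nonempty compact
`k`-dimensional rational convex polytope and let `p(m) = #(ℤ^k ∩ mP)` be the number of
lattice points in the `m`-th dilate.  Then `p` is a quasi-polynomial in `m` whose period
divides any (in particular the smallest) positive integer `l` such that `lP` is a lattice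
polytope. -/
theorem ehrhart_quasi_polynomial
    (k : ℕ) (P : Set (Fin k → ℝ))
    (hrat : ∃ (n : ℕ) (v : Fin n → Fin k → ℤ) (r : Fin n → ℤ),
        P = {μ : Fin k → ℝ | ∀ i, (r i : ℝ) ≤ ∑ j, μ j * (v i j : ℝ)})
    (hcpt : IsCompact P) (hne : P.Nonempty)
    (hdim : affineSpan ℝ P = ⊤) :
    ∀ l : ℕ, 0 < l →
      -- `lP` is a lattice polytope: it is the convex hull of its lattice points
      ((l : ℝ) • P =
        convexHull ℝ {x ∈ (l : ℝ) • P | ∀ j, ∃ z : ℤ, x j = (z : ℝ)}) →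
      ∃ q : ℕ → Polynomial ℚ, ∀ m : ℕ,
        (Set.ncard {x : Fin k → ℤ | (fun j => (x j : ℝ)) ∈ (m : ℝ) • P} : ℚ)
          = (q (m % l)).eval (m : ℚ) := by
  intro l hl hhull
  have hl' : (l : ℝ) ≠ 0 := by exact_mod_cast hl.ne'
  have hfin : {z : Fin k → ℤ | (fun j => (z j : ℝ)) ∈ (l : ℝ) • P}.Finite := by
    obtain ⟨B, hB⟩ := (hcpt.smul (l : ℝ)).isBounded.exists_norm_le
    refine Set.Finite.of_finite_image (f := fun z j => (z j : ℝ))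
      ((Set.Finite.pi (ι := Fin k) fun _ => finite_abs_le_intCast B).subset ?_) ?_
    · rintro _ ⟨z, hz, rfl⟩ j -
      exact ⟨(norm_le_pi_norm (fun j => (z j : ℝ)) j).trans (hB _ hz), z j, rfl⟩
    · intro a _ b _ h
      funext j
      simpa using congrFun h j
  obtain ⟨n, w, -, hw⟩ := hfin.fin_param
  have hrange : {x ∈ (l : ℝ) • P | ∀ j, ∃ z : ℤ, x j = (z : ℝ)} =
      Set.range fun i j => (w i j : ℝ) := by
    ext x
    constructor
    · rintro ⟨hx, hz⟩
      choose z hz using hz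
      obtain rfl : x = fun j => (z j : ℝ) := funext hz
      obtain ⟨i, rfl⟩ : z ∈ Set.range w := hw ▸ hx
      exact ⟨i, rfl⟩
    · rintro ⟨i, rfl⟩
      have : w i ∈ {z : Fin k → ℤ | (fun j => (z j : ℝ)) ∈ (l : ℝ) • P} := hw ▸ ⟨i, rfl⟩
      exact ⟨this, fun j => ⟨w i j, rfl⟩⟩
  rw [hrange] at hhull
  obtain ⟨n, rfl⟩ : ∃ n', n = n' + 1 := by
    refine Nat.exists_eq_succ_of_ne_zero ?_
    rintro rfl
    rw [Set.range_eq_empty, convexHull_empty] at hhull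
    exact (hne.smul_set (a := (l : ℝ))).ne_empty hhull
  obtain ⟨q, hq⟩ := ncard_sum_smul_mem hl w
  refine ⟨q, fun m => ?_⟩
  rw [← hq m]
  congr 2
  ext x
  simp only [Set.mem_ofPred_eq]
  have hdilate : ∀ p : Fin k → ℝ, p ∈ P ↔ ∃ b : Fin (n + 1) → ℝ, (∀ i, 0 ≤ b i) ∧
      ∑ i, b i = 1 ∧ ∑ i, b i • (fun j => (w i j : ℝ)) = (l : ℝ) • p := by
    intro p
    rw [← mem_convexHull_range_iff, ← hhull, Set.smul_mem_smul_set_iff₀ hl']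
  have hsum : ∀ (b : Fin (n + 1) → ℝ) (j : Fin k),
      (∑ i, b i • (fun j => (w i j : ℝ))) j = ∑ i, b i * (w i j : ℝ) := by
    intro b j
    simp [Finset.sum_apply]
  constructor
  · rintro ⟨p, hp, hpx⟩
    obtain ⟨b, hb0, hb1, hbp⟩ := (hdilate p).1 hp
    refine ⟨fun i => m / l * b i, fun i => mul_nonneg (by positivity) (hb0 i), ?_, fun j => ?_⟩
    · rw [← Finset.mul_sum, hb1]
      field_simp
    · simp only [mul_assoc, ← Finset.mul_sum]
      rw [← hsum, hbp, ← congrFun hpx j]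
      simp only [Pi.smul_apply, smul_eq_mul]
      field_simp
  · rintro ⟨c, hc0, hcm, hcx⟩
    rcases Nat.eq_zero_or_pos m with rfl | hm
    · have hc : ∀ i, c i = 0 := by
        have : ∑ i, c i = 0 := by simpa [hl'] using hcm
        simpa [Finset.sum_eq_zero_iff_of_nonneg fun i _ => hc0 i] using this
      obtain ⟨p, hp⟩ := hne
      refine ⟨p, hp, funext fun j => ?_⟩
      simp [← hcx, hc]
    · have hm' : (m : ℝ) ≠ 0 := by exact_mod_cast hm.ne'
      rw [Set.mem_smul_set_iff_inv_smul_mem₀ hm', hdilate]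
      refine ⟨fun i => l / m * c i, fun i => mul_nonneg (by positivity) (hc0 i), ?_, ?_⟩
      · rw [← Finset.mul_sum, div_mul_eq_mul_div, hcm, div_self hm']
      · funext j
        rw [hsum]
        simp only [mul_assoc, ← Finset.mul_sum, hcx, Pi.smul_apply, smul_eq_mul]
        field_simp
end

section
/- Let P ⊂ ℝ^k be a nonempty compact k-dimensional rational convex polytope with Ehrhart counting quasi-polynomial p(m) = #(ℤ^k ∩ mP) for m ≥ 0. Then p satisfies the Ehrhart reciprocity law: for every positive integer m, p(−m) = (−1)^k · #(ℤ^k ∩ int(mP)), where p(−m) denotes the evaluation of the quasi-polynomial at −m. -/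
open scoped Classical Pointwise

/-- Functions annihilated by a finite product of difference operators with steps in `V`. -/
inductive DiffTorsion {G : Type*} [AddCommGroup G] (V : Set G) : (G → ℚ) → Prop
  | zero : DiffTorsion V 0
  | step {v : G} {f : G → ℚ} (hv : v ∈ V) (hf : DiffTorsion V (fwdDiff v f)) : DiffTorsion V f

lemma fwdDiff_comm {G : Type*} [AddCommGroup G] (v w : G) (f : G → ℚ) :
    fwdDiff v (fwdDiff w f) = fwdDiff w (fwdDiff v f) := by
  funext x
  simp only [fwdDiff, add_right_comm x v w]
  ring

namespace DiffTorsion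

variable {G : Type*} [AddCommGroup G] {V : Set G} {f g : G → ℚ}

lemma fwdDiff (hf : DiffTorsion V f) (v : G) : DiffTorsion V (fwdDiff v f) := by
  induction hf with
  | zero =>
    have : _root_.fwdDiff v (0 : G → ℚ) = 0 := by funext x; simp [_root_.fwdDiff]
    rw [this]
    exact zero
  | step hw _ ih => exact step hw (fwdDiff_comm v _ _ ▸ ih)

lemma add (hf : DiffTorsion V f) (hg : DiffTorsion V g) : DiffTorsion V (f + g) := by
  induction hf generalizing g with
  | zero => rwa [zero_add]
  | step hv _ ih =>
    refine step hv ?_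
    rw [fwdDiff_add]
    exact ih (hg.fwdDiff _)

lemma const_smul (c : ℚ) (hf : DiffTorsion V f) : DiffTorsion V (c • f) := by
  induction hf with
  | zero => rw [smul_zero]; exact zero
  | step hv _ ih =>
    refine step hv ?_
    rwa [fwdDiff_const_smul]

lemma sub (hf : DiffTorsion V f) (hg : DiffTorsion V g) : DiffTorsion V (f - g) := by
  have := hf.add (hg.const_smul (-1))
  rwa [neg_one_smul, ← sub_eq_add_neg] at this

lemma of_periodic {v : G} (hv : v ∈ V) (h : ∀ x, f (x + v) = f x) : DiffTorsion V f := by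
  refine step hv ?_
  have : _root_.fwdDiff v f = 0 := by funext x; simp [_root_.fwdDiff, h]
  rw [this]
  exact zero

lemma of_iterate {v : G} (hv : v ∈ V) (n : ℕ) (h : (_root_.fwdDiff v)^[n] f = 0) :
    DiffTorsion V f := by
  induction n generalizing f with
  | zero => rw [show f = 0 from h]; exact zero
  | succ n ih => exact step hv (ih h)

/-- A torsion function on `ℤ` that vanishes near `-∞` is zero. -/
lemma eq_zero_of_eventually {h : ℤ → ℚ} (hh : DiffTorsion {v : ℤ | v ≠ 0} h)
    (h0 : ∃ M, ∀ m ≤ M, h m = 0) : h = 0 := by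
  induction hh with
  | zero => rfl
  | @step v f hv _ ih =>
    obtain ⟨M, hM⟩ := h0
    have hper : Function.Periodic f v := by
      intro x
      have := congrFun (ih ⟨M - |v|, fun m hm => ?_⟩) x
      · simpa [_root_.fwdDiff, sub_eq_zero] using this
      · have h1 := neg_abs_le v
        have h2 := le_abs_self v
        simp [_root_.fwdDiff, hM m (by linarith [abs_nonneg v]), hM (m + v) (by linarith)]
    funext x
    have hv1 : 1 ≤ v * v := by
      have := mul_self_pos.mpr hv
      omega
    have := hper.sub_zsmul_eq (x := x) (v * (|x| + |M|))
    rw [← this]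
    apply hM
    rw [smul_eq_mul]
    nlinarith [le_abs_self x, neg_abs_le M, abs_nonneg x, abs_nonneg M]

end DiffTorsion

/-- The restriction of polynomials to residue classes is a torsion function. -/
lemma DiffTorsion.of_quasiPolynomial {l : ℕ} (hl : 0 < l) (Q : ℤ → Polynomial ℚ)
    (hQ : ∀ t, Q (t + l) = Q t) (n : ℕ) (hn : ∀ t, (Q t).natDegree < n) :
    DiffTorsion {v : ℤ | v ≠ 0} (fun t => (Q t).eval (t : ℚ)) := by
  refine of_iterate (v := (l : ℤ)) (by simp; omega) n ?_
  funext t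
  have hQk : ∀ k : ℕ, Q (t + k • (l : ℤ)) = Q t := by
    intro k
    induction k with
    | zero => simp
    | succ k ih => rw [succ_nsmul, ← add_assoc, hQ, ih]
  have hdeg : ((Q t).comp (Polynomial.C (l : ℚ) * Polynomial.X + Polynomial.C (t : ℚ))).natDegree
      < n := by
    refine lt_of_le_of_lt ?_ (hn t)
    rw [Polynomial.natDegree_comp, Polynomial.natDegree_linear (by positivity), mul_one]
  have := congrFun (Polynomial.fwdDiff_iter_eq_zero_of_degree_lt hdeg) 0
  rw [fwdDiff_iter_eq_sum_shift] at this ⊢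
  rw [Pi.zero_apply] at this ⊢
  rw [← this]
  refine Finset.sum_congr rfl fun k _ => ?_
  rw [hQk]
  simp [add_comm, mul_comm]

section Fibers

variable {H : Type*} [AddCommGroup H] {f : H × ℤ → ℚ}

lemma finite_support_fwdDiff (hf : ∀ t, {x | f (x, t) ≠ 0}.Finite) (v : H × ℤ) (t : ℤ) :
    {x | fwdDiff v f (x, t) ≠ 0}.Finite := by
  have h1 : {x | f (x + v.1, t + v.2) ≠ 0}.Finite :=
    (hf (t + v.2)).preimage (add_left_injective v.1).injOn
  refine (h1.union (hf t)).subset fun x hx => ?_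
  by_contra hcon
  simp only [Set.mem_union, Set.mem_ofPred_eq, not_or, not_not] at hcon
  apply hx
  rw [fwdDiff, hcon.2, sub_zero]
  exact hcon.1

lemma DiffTorsion.finsum_fiber (ht : DiffTorsion {v : H × ℤ | v.2 ≠ 0} f)
    (hf : ∀ t, {x | f (x, t) ≠ 0}.Finite) :
    DiffTorsion {v : ℤ | v ≠ 0} (fun t => ∑ᶠ x, f (x, t)) := by
  induction ht with
  | zero =>
    simp only [Pi.zero_apply, finsum_zero]
    exact zero
  | @step v f hv _ ih =>
    refine step hv ?_
    convert ih (finite_support_fwdDiff hf v) using 1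
    funext t
    have h1 : {x | f (x + v.1, t + v.2) ≠ 0}.Finite :=
      (hf (t + v.2)).preimage (add_left_injective v.1).injOn
    simp only [_root_.fwdDiff]
    rw [finsum_sub_distrib (by exact h1) (hf t)]
    congr 1
    exact (finsum_comp_equiv (Equiv.addRight v.1) (f := fun x => f (x, t + v.2))).symm

variable [IsAddTorsionFree H]

/-- A function with finite support on each fiber is zero if it is periodic along the fibers. -/
lemma eq_zero_of_fwdDiff_eq_zero (hf : ∀ t, {x | f (x, t) ≠ 0}.Finite) {v : H × ℤ}
    (hv : v ≠ 0) (hv2 : v.2 = 0) (h : fwdDiff v f = 0) : f = 0 := by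
  obtain ⟨w, s⟩ := v
  obtain rfl : s = 0 := hv2
  have hw : w ≠ 0 := by rintro rfl; exact hv rfl
  funext ⟨x, t⟩
  by_contra hx
  have hper : ∀ n : ℕ, f (x + n • w, t) = f (x, t) := by
    intro n
    induction n with
    | zero => simp
    | succ n ih =>
      have := congrFun h (x + n • w, t)
      simp only [fwdDiff, Pi.zero_apply, sub_eq_zero, Prod.mk_add_mk, add_zero] at this
      rw [succ_nsmul, ← add_assoc, this, ih]
  refine Set.infinite_of_injective_forall_mem (f := fun n : ℕ => x + n • w) ?_ ?_ (hf t)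
  · intro m n hmn
    have := add_left_cancel hmn
    simpa using smul_left_injective ℤ hw (a₁ := (m : ℤ)) (a₂ := (n : ℤ)) (by simpa using this)
  · intro n
    rw [Set.mem_ofPred_eq, hper]
    exact hx

lemma DiffTorsion.transverse (ht : DiffTorsion {v | v ≠ 0} f)
    (hf : ∀ t, {x | f (x, t) ≠ 0}.Finite) : DiffTorsion {v : H × ℤ | v.2 ≠ 0} f := by
  induction ht with
  | zero => exact zero
  | @step v f hv _ ih =>
    have ih := ih (finite_support_fwdDiff hf v)
    by_cases hv2 : v.2 = 0
    · generalize hg : _root_.fwdDiff v f = g at ih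
      clear * - hg ih hv hv2 hf
      induction ih generalizing f with
      | zero => rw [eq_zero_of_fwdDiff_eq_zero hf hv hv2 hg]; exact zero
      | @step w g hw _ ih =>
        exact step hw (ih (finite_support_fwdDiff hf w) (by rw [fwdDiff_comm, hg]))
    · exact step hv2 ih

end Fibers

section Cones

variable {G ι : Type*} [AddCommGroup G]

/-- The difference of the indicator function of the open cone `{x ∈ Λ | ∀ i ∈ s, 0 < a i x}` and of
the signed indicator function of the negative of the corresponding closed cone. -/
noncomputable def reciprocityDefect (Λ : Submodule ℤ G) (s : Finset ι) (a : ι → G →ₗ[ℤ] ℤ) :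
    G → ℚ := fun x =>
  (if x ∈ Λ ∧ ∀ i ∈ s, 0 < a i x then 1 else 0) -
    (-1) ^ Module.finrank ℤ Λ * (if x ∈ Λ ∧ ∀ i ∈ s, a i x ≤ 0 then 1 else 0)

variable (Λ : Submodule ℤ G)

lemma exists_ne_zero_forall_eq_zero (s : Finset ι) (a : ι → G →ₗ[ℤ] ℤ)
    (hs : s.card < Module.finrank ℤ Λ) : ∃ v ∈ Λ, v ≠ 0 ∧ ∀ i ∈ s, a i v = 0 := by
  by_contra! hcon
  let ψ : Λ →ₗ[ℤ] (s → ℤ) := LinearMap.pi fun i => (a i).domRestrict Λ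
  have hinj : Function.Injective ψ := by
    rw [← LinearMap.ker_eq_bot, LinearMap.ker_eq_bot']
    intro v hv
    by_contra hv0
    obtain ⟨i, hi, hne⟩ := hcon v v.2 (by simpa using hv0)
    exact hne (congrFun hv ⟨i, hi⟩)
  have := LinearMap.finrank_le_finrank_of_injective hinj
  simp at this
  omega

lemma DiffTorsion.reciprocityDefect_of_card_le (s : Finset ι) (a : ι → G →ₗ[ℤ] ℤ)
    (hs : s.card ≤ Module.finrank ℤ Λ) :
    DiffTorsion {v | v ≠ 0} (reciprocityDefect Λ s a) := by
  rcases hs.lt_or_eq with hlt | heq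
  · obtain ⟨v, hv, hv0, hav⟩ := exists_ne_zero_forall_eq_zero Λ s a hlt
    refine of_periodic (v := v) hv0 fun x => ?_
    have h1 : x + v ∈ Λ ↔ x ∈ Λ := Λ.add_mem_iff_left hv
    have h2 : ∀ i ∈ s, a i (x + v) = a i x := fun i hi => by rw [map_add, hav i hi, add_zero]
    have h3 : (∀ i ∈ s, 0 < a i (x + v)) ↔ ∀ i ∈ s, 0 < a i x :=
      forall₂_congr fun i hi => by rw [h2 i hi]
    have h4 : (∀ i ∈ s, a i (x + v) ≤ 0) ↔ ∀ i ∈ s, a i x ≤ 0 :=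
      forall₂_congr fun i hi => by rw [h2 i hi]
    simp only [reciprocityDefect, h1, h3, h4]
  · -- Flip the inequalities one at a time; each flip costs the indicator of a cone with a line.
    have key : ∀ t ⊆ s, DiffTorsion {v | v ≠ 0} fun x : G =>
        ((if x ∈ Λ ∧ ∀ i ∈ s, 0 < a i x then 1 else 0 : ℚ) - (-1) ^ t.card *
          (if x ∈ Λ ∧ ∀ i ∈ s, (i ∉ t → 0 < a i x) ∧ (i ∈ t → a i x ≤ 0) then 1 else 0)) := by
      intro t
      induction t using Finset.induction_on with
      | empty =>
        intro _
        simp only [Finset.notMem_empty, not_false_eq_true, forall_const, false_imp_iff, and_true,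
          Finset.card_empty, pow_zero, one_mul, sub_self]
        exact zero
      | insert j t hj ih =>
        intro ht
        have hjs : j ∈ s := ht (Finset.mem_insert_self j t)
        have ih := ih ((Finset.subset_insert j t).trans ht)
        obtain ⟨v, hv, hv0, hav⟩ := exists_ne_zero_forall_eq_zero Λ (s.erase j) a
          (by rw [Finset.card_erase_of_mem hjs]; have := Finset.card_pos.mpr ⟨j, hjs⟩; omega)
        have hper : DiffTorsion {v | v ≠ 0} fun x : G =>
            (if x ∈ Λ ∧ ∀ i ∈ s.erase j, (i ∉ t → 0 < a i x) ∧ (i ∈ t → a i x ≤ 0)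
              then 1 else 0 : ℚ) := by
          refine of_periodic (v := v) hv0 fun x => ?_
          have h1 : x + v ∈ Λ ↔ x ∈ Λ := Λ.add_mem_iff_left hv
          have h2 : ∀ i ∈ s.erase j, a i (x + v) = a i x := fun i hi => by
            rw [map_add, hav i hi, add_zero]
          have h3 : (∀ i ∈ s.erase j, (i ∉ t → 0 < a i (x + v)) ∧ (i ∈ t → a i (x + v) ≤ 0)) ↔
              ∀ i ∈ s.erase j, (i ∉ t → 0 < a i x) ∧ (i ∈ t → a i x ≤ 0) :=
            forall₂_congr fun i hi => by rw [h2 i hi]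
          simp only [h1, h3]
        convert ih.add (hper.const_smul ((-1) ^ t.card)) using 1
        funext x
        have e1 : (∀ i ∈ s, (i ∉ t → 0 < a i x) ∧ (i ∈ t → a i x ≤ 0)) ↔
            (0 < a j x ∧ ∀ i ∈ s.erase j, (i ∉ t → 0 < a i x) ∧ (i ∈ t → a i x ≤ 0)) := by
          conv_lhs => rw [← Finset.insert_erase hjs, Finset.forall_mem_insert]
          simp [hj]
        have e2 : (∀ i ∈ s, (i ∉ insert j t → 0 < a i x) ∧ (i ∈ insert j t → a i x ≤ 0)) ↔
            (a j x ≤ 0 ∧ ∀ i ∈ s.erase j, (i ∉ t → 0 < a i x) ∧ (i ∈ t → a i x ≤ 0)) := by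
          conv_lhs => rw [← Finset.insert_erase hjs, Finset.forall_mem_insert]
          refine and_congr (by simp) (forall₂_congr fun i hi => ?_)
          simp [Finset.ne_of_mem_erase hi]
        simp only [e1, e2, Finset.card_insert_of_notMem hj, Pi.add_apply, Pi.smul_apply,
          smul_eq_mul, pow_succ]
        obtain ⟨p, hp⟩ : ∃ p : Prop,
          (∀ i ∈ s.erase j, (i ∉ t → 0 < a i x) ∧ (i ∈ t → a i x ≤ 0)) ↔ p := ⟨_, Iff.rfl⟩
        simp only [hp]
        by_cases hx : x ∈ Λ <;> by_cases hp : p <;> rcases lt_or_ge 0 (a j x) with h | h <;>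
          simp [hx, hp, h, not_le_of_gt, not_lt_of_ge]
    convert key s subset_rfl using 1
    funext x
    have e : (∀ i ∈ s, (i ∉ s → 0 < a i x) ∧ (i ∈ s → a i x ≤ 0)) ↔ ∀ i ∈ s, a i x ≤ 0 :=
      forall₂_congr fun i hi => by simp [hi]
    simp only [reciprocityDefect, e, heq]

variable {Λ} {s : Finset ι} {a : ι → G →ₗ[ℤ] ℤ} {j : ι} {y : G}

/-- A constraint whose reversal is infeasible is redundant. -/
lemma reciprocityDefect_eq_erase (hj : j ∈ s) (hy : y ∈ Λ) (hpos : ∀ i ∈ s, 0 < a i y)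
    (hred : ∀ x ∈ Λ, (∀ i ∈ s.erase j, 0 < a i x) → 0 ≤ a j x) :
    reciprocityDefect Λ s a = reciprocityDefect Λ (s.erase j) a := by
  have hposE : ∀ i ∈ s.erase j, 0 < a i y := fun i hi => hpos i (Finset.mem_of_mem_erase hi)
  have h1 : ∀ x ∈ Λ, (∀ i ∈ s.erase j, 0 < a i x) → 0 < a j x := by
    intro x hx hxs
    by_contra hcon
    have hxj : a j x = 0 := le_antisymm (not_lt.mp hcon) (hred x hx hxs)
    have hN : ∀ i ∈ s.erase j, a i y < ∑ i ∈ s.erase j, a i y + 1 := fun i hi =>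
      Int.lt_add_one_of_le
        (Finset.single_le_sum (f := fun i => a i y) (fun i hi => (hposE i hi).le) hi)
    have := hred ((∑ i ∈ s.erase j, a i y + 1) • x - y) (Λ.sub_mem (Λ.smul_mem _ hx) hy) ?_
    · rw [map_sub, map_smul, hxj, smul_zero] at this
      linarith [hpos j hj]
    · intro i hi
      rw [map_sub, map_smul, smul_eq_mul]
      have h1 := hxs i hi
      have h2 := hN i hi
      have h3 := hposE i hi
      nlinarith
  have h2 : ∀ x ∈ Λ, (∀ i ∈ s.erase j, a i x ≤ 0) → a j x ≤ 0 := by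
    intro x hx hxs
    by_contra! hcon
    have := hred (y - (a j y + 1) • x) (Λ.sub_mem hy (Λ.smul_mem _ hx)) ?_
    · rw [map_sub, map_smul, smul_eq_mul] at this
      nlinarith [hpos j hj]
    · intro i hi
      rw [map_sub, map_smul, smul_eq_mul]
      nlinarith [hxs i hi, hposE i hi, hpos j hj]
  funext x
  have e1 : (x ∈ Λ ∧ ∀ i ∈ s, 0 < a i x) ↔ (x ∈ Λ ∧ ∀ i ∈ s.erase j, 0 < a i x) := by
    conv_lhs => rw [← Finset.insert_erase hj, Finset.forall_mem_insert]
    exact ⟨fun h => ⟨h.1, h.2.2⟩, fun h => ⟨h.1, h1 x h.1 h.2, h.2⟩⟩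
  have e2 : (x ∈ Λ ∧ ∀ i ∈ s, a i x ≤ 0) ↔ (x ∈ Λ ∧ ∀ i ∈ s.erase j, a i x ≤ 0) := by
    conv_lhs => rw [← Finset.insert_erase hj, Finset.forall_mem_insert]
    exact ⟨fun h => ⟨h.1, h.2.2⟩, fun h => ⟨h.1, h2 x h.1 h.2, h.2⟩⟩
  simp only [reciprocityDefect, e1, e2]

variable [Module.Finite ℤ G]

lemma finrank_inf_ker_add_one (φ : G →ₗ[ℤ] ℤ) (hy : y ∈ Λ) (hφ : φ y ≠ 0) :
    Module.finrank ℤ (Λ ⊓ LinearMap.ker φ : Submodule ℤ G) + 1 = Module.finrank ℤ Λ := by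
  let ψ := φ.domRestrict Λ
  have h1 : Module.finrank ℤ (Λ ⊓ LinearMap.ker φ : Submodule ℤ G)
      = Module.finrank ℤ (LinearMap.ker ψ) := by
    rw [← Submodule.map_comap_subtype, Submodule.finrank_map_subtype_eq]
    rfl
  have h2 : Module.finrank ℤ (LinearMap.range ψ) = 1 := by
    apply le_antisymm
    · simpa using Submodule.finrank_le (LinearMap.range ψ)
    · rw [Nat.one_le_iff_ne_zero, Ne, Submodule.finrank_eq_zero]
      intro h
      have : ψ ⟨y, hy⟩ ∈ LinearMap.range ψ := LinearMap.mem_range_self _ _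
      rw [h, Submodule.mem_bot] at this
      exact hφ this
  have h3 := Submodule.finrank_quotient_add_finrank (LinearMap.ker ψ)
  rw [(LinearMap.quotKerEquivRange ψ).finrank_eq, h2] at h3
  omega

/-- Cutting a cone by a hyperplane. -/
lemma reciprocityDefect_add_flip (hj : j ∈ s) (hy : y ∈ Λ) (hpos : a j y ≠ 0) :
    reciprocityDefect Λ s a + reciprocityDefect Λ s (Function.update a j (-a j)) +
      reciprocityDefect (Λ ⊓ LinearMap.ker (a j)) (s.erase j) a
        = reciprocityDefect Λ (s.erase j) a := by
  have hrank := finrank_inf_ker_add_one (a j) hy hpos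
  funext x
  have e1 : (∀ i ∈ s, 0 < a i x) ↔ 0 < a j x ∧ ∀ i ∈ s.erase j, 0 < a i x := by
    conv_lhs => rw [← Finset.insert_erase hj, Finset.forall_mem_insert]
  have e2 : (∀ i ∈ s, a i x ≤ 0) ↔ a j x ≤ 0 ∧ ∀ i ∈ s.erase j, a i x ≤ 0 := by
    conv_lhs => rw [← Finset.insert_erase hj, Finset.forall_mem_insert]
  have e3 : (∀ i ∈ s, 0 < Function.update a j (-a j) i x) ↔
      a j x < 0 ∧ ∀ i ∈ s.erase j, 0 < a i x := by
    conv_lhs => rw [← Finset.insert_erase hj, Finset.forall_mem_insert]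
    refine and_congr (by simp) (forall₂_congr fun i hi => ?_)
    rw [Function.update_of_ne (Finset.ne_of_mem_erase hi)]
  have e4 : (∀ i ∈ s, Function.update a j (-a j) i x ≤ 0) ↔
      0 ≤ a j x ∧ ∀ i ∈ s.erase j, a i x ≤ 0 := by
    conv_lhs => rw [← Finset.insert_erase hj, Finset.forall_mem_insert]
    refine and_congr (by simp) (forall₂_congr fun i hi => ?_)
    rw [Function.update_of_ne (Finset.ne_of_mem_erase hi)]
  simp only [Pi.add_apply, reciprocityDefect, e1, e2, e3, e4, ← hrank, pow_succ,
    Submodule.mem_inf, LinearMap.mem_ker]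
  obtain ⟨p, hp⟩ : ∃ p : Prop, (∀ i ∈ s.erase j, 0 < a i x) ↔ p := ⟨_, Iff.rfl⟩
  obtain ⟨q, hq⟩ : ∃ q : Prop, (∀ i ∈ s.erase j, a i x ≤ 0) ↔ q := ⟨_, Iff.rfl⟩
  simp only [hp, hq]
  generalize a j x = t
  by_cases hx : x ∈ Λ <;> by_cases hp : p <;> by_cases hq : q <;>
    rcases lt_trichotomy t 0 with h | rfl | h <;>
    simp [*, le_of_lt, ne_of_lt, ne_of_gt, not_lt_of_gt, not_le_of_gt, add_comm]

variable [Module.Free ℤ G]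

lemma exists_relation_of_finrank_lt_card (hs : Module.finrank ℤ Λ < s.card) :
    ∃ c : ι → ℤ, (∃ i ∈ s, c i ≠ 0) ∧ ∀ x ∈ Λ, ∑ i ∈ s, c i * a i x = 0 := by
  have hdep : ¬ LinearIndependent ℤ fun i : s => (a i).domRestrict Λ := by
    intro h
    have h1 := h.fintype_card_le_finrank
    rw [Fintype.card_coe, Module.finrank_linearMap, Module.finrank_self, mul_one] at h1
    omega
  rw [Fintype.not_linearIndependent_iff] at hdep
  obtain ⟨c, hc, ⟨i, hi⟩, hne⟩ := hdep
  refine ⟨fun j => if hj : j ∈ s then c ⟨j, hj⟩ else 0, ⟨i, hi, by simpa [hi] using hne⟩, ?_⟩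
  intro x hx
  have := LinearMap.congr_fun hc ⟨x, hx⟩
  simp only [LinearMap.coe_sum, Finset.sum_apply, LinearMap.smul_apply,
    LinearMap.domRestrict_apply, LinearMap.zero_apply, smul_eq_mul] at this
  rw [← this, ← Finset.sum_coe_sort s]
  simp

theorem DiffTorsion.reciprocityDefect (hy : y ∈ Λ) (hpos : ∀ i ∈ s, 0 < a i y) :
    DiffTorsion {v | v ≠ 0} (reciprocityDefect Λ s a) := by
  induction s using Finset.strongInduction generalizing Λ a y with
  | H s ih =>
  rcases le_or_gt s.card (Module.finrank ℤ Λ) with hle | hlt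
  · exact reciprocityDefect_of_card_le Λ s a hle
  obtain ⟨c, hc, hrel⟩ := exists_relation_of_finrank_lt_card (a := a) hlt
  induction hn : (s.filter fun i => c i < 0).card generalizing a c y with
  | zero =>
    exfalso
    rw [Finset.card_eq_zero, Finset.filter_eq_empty_iff] at hn
    obtain ⟨i, hi, hci⟩ := hc
    have := (Finset.sum_eq_zero_iff_of_nonneg fun i hi =>
      mul_nonneg (not_lt.mp (hn hi)) (hpos i hi).le).mp (hrel y hy) i hi
    exact (mul_ne_zero hci (hpos i hi).ne') this
  | succ n ihn =>
    obtain ⟨j, hjf⟩ :=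
      Finset.card_pos.mp (hn.symm ▸ n.succ_pos : 0 < (s.filter fun i => c i < 0).card)
    obtain ⟨hj, hcj⟩ := Finset.mem_filter.mp hjf
    have hposE : ∀ i ∈ s.erase j, 0 < a i y := fun i hi => hpos i (Finset.mem_of_mem_erase hi)
    have hE := ih _ (Finset.erase_ssubset hj) hy hposE
    by_cases hred : ∀ x ∈ Λ, (∀ i ∈ s.erase j, 0 < a i x) → 0 ≤ a j x
    · rwa [reciprocityDefect_eq_erase hj hy hpos hred]
    push Not at hred
    obtain ⟨z, hz, hzE, hzj⟩ := hred
    have hflip : DiffTorsion {v | v ≠ 0}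
        (_root_.reciprocityDefect Λ s (Function.update a j (-a j))) := by
      refine ihn hz ?_ (Function.update c j (-c j)) ?_ ?_ ?_
      · intro i hi
        by_cases hij : i = j
        · subst hij; simpa using hzj
        · rw [Function.update_of_ne hij]
          exact hzE i (Finset.mem_erase.mpr ⟨hij, hi⟩)
      · exact ⟨j, hj, by simpa using hcj.ne⟩
      · intro x hx
        rw [← hrel x hx]
        refine Finset.sum_congr rfl fun i _ => ?_
        by_cases hij : i = j
        · subst hij; simp
        · rw [Function.update_of_ne hij, Function.update_of_ne hij]
      · have : (s.filter fun i => Function.update c j (-c j) i < 0)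
            = (s.filter fun i => c i < 0).erase j := by
          ext i
          by_cases hij : i = j
          · subst hij; simp [hcj.le]
          · simp [hij]
        rw [this, Finset.card_erase_of_mem hjf, hn]
        rfl
    have hwall : DiffTorsion {v | v ≠ 0}
        (_root_.reciprocityDefect (Λ ⊓ LinearMap.ker (a j)) (s.erase j) a) := by
      refine ih _ (Finset.erase_ssubset hj) (y := a j y • z - a j z • y)
        ⟨Λ.sub_mem (Λ.smul_mem _ hz) (Λ.smul_mem _ hy), ?_⟩ ?_
      · simp [mul_comm]
      · intro i hi
        simp only [map_sub, map_smul, smul_eq_mul]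
        nlinarith [mul_pos (hpos j hj) (hzE i hi), mul_pos (neg_pos.mpr hzj) (hposE i hi)]
    have := (hE.sub hwall).sub hflip
    rw [← reciprocityDefect_add_flip hj hy (hpos j hj).ne'] at this
    convert this using 1
    abel

end Cones

section Polyhedra

variable {k n : ℕ} (v : Fin n → Fin k → ℤ) (r : Fin n → ℤ)

/-- The rational polyhedron cut out by the inequalities `r i ≤ ∑ j, μ j * v i j`. -/
def rationalPolyhedron : Set (Fin k → ℝ) :=
  {μ | ∀ i, (r i : ℝ) ≤ ∑ j, μ j * (v i j : ℝ)}

variable {v r}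

lemma mem_smul_rationalPolyhedron (hb : Bornology.IsBounded (rationalPolyhedron v r))
    (hne : (rationalPolyhedron v r).Nonempty) (m : ℕ) (μ : Fin k → ℝ) :
    μ ∈ (m : ℝ) • rationalPolyhedron v r ↔ ∀ i, (m : ℝ) * r i ≤ ∑ j, μ j * (v i j : ℝ) := by
  rcases Nat.eq_zero_or_pos m with rfl | hm
  · rw [Nat.cast_zero, Set.zero_smul_set hne, Set.mem_zero]
    refine ⟨by rintro rfl; simp, fun h => ?_⟩
    obtain ⟨p, hp⟩ := hne
    obtain ⟨R, hR⟩ := hb.exists_norm_le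
    by_contra hμ
    have hμ : 0 < ‖μ‖ := norm_pos_iff.mpr hμ
    obtain ⟨N, hN⟩ := exists_nat_gt ((R + ‖p‖) / ‖μ‖)
    rw [div_lt_iff₀ hμ] at hN
    have hmem : p + (N : ℝ) • μ ∈ rationalPolyhedron v r := by
      intro i
      have h1 := hp i
      have h2 := mul_nonneg (Nat.cast_nonneg (α := ℝ) N) (by simpa using h i)
      simp only [Pi.add_apply, Pi.smul_apply, smul_eq_mul, add_mul, Finset.sum_add_distrib,
        mul_assoc, ← Finset.mul_sum]
      linarith
    have h3 := norm_le_norm_add_norm_sub' ((N : ℝ) • μ) (-p)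
    rw [sub_neg_eq_add, norm_neg, norm_smul, Real.norm_natCast, add_comm _ p] at h3
    linarith [hR _ hmem]
  · have hm' : (0 : ℝ) < m := by exact_mod_cast hm
    rw [Set.mem_smul_set_iff_inv_smul_mem₀ hm'.ne']
    refine forall_congr' fun i => ?_
    simp only [Pi.smul_apply, smul_eq_mul, mul_assoc, ← Finset.mul_sum]
    rw [inv_mul_eq_div, le_div_iff₀ hm', mul_comm]

lemma mem_interior_smul_rationalPolyhedron (hb : Bornology.IsBounded (rationalPolyhedron v r))
    (hne : (rationalPolyhedron v r).Nonempty) (m : ℕ) (μ : Fin k → ℝ) :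
    μ ∈ interior ((m : ℝ) • rationalPolyhedron v r) ↔
      ∀ i, v i ≠ 0 → (m : ℝ) * r i < ∑ j, μ j * (v i j : ℝ) := by
  have hset : (m : ℝ) • rationalPolyhedron v r
      = ⋂ i, {μ : Fin k → ℝ | (m : ℝ) * r i ≤ ∑ j, μ j * (v i j : ℝ)} := by
    ext μ
    rw [mem_smul_rationalPolyhedron hb hne, Set.mem_iInter]
    rfl
  rw [hset, interior_iInter_of_finite, Set.mem_iInter]
  refine forall_congr' fun i => ?_
  by_cases hv : v i = 0
  · obtain ⟨p, hp⟩ := hne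
    have hr : (r i : ℝ) ≤ 0 := by simpa [hv] using hp i
    have : {μ : Fin k → ℝ | (m : ℝ) * r i ≤ ∑ j, μ j * (v i j : ℝ)} = Set.univ := by
      ext μ
      simpa [hv] using mul_nonpos_of_nonneg_of_nonpos (Nat.cast_nonneg m) hr
    rw [this]
    simp [hv]
  · let φ : (Fin k → ℝ) →L[ℝ] ℝ := ∑ j, (v i j : ℝ) • ContinuousLinearMap.proj j
    have hφ : ∀ μ, φ μ = ∑ j, μ j * (v i j : ℝ) := fun μ => by simp [φ, mul_comm]
    have hφ0 : φ ≠ 0 := by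
      intro h
      refine hv (funext fun j => ?_)
      have := hφ (Pi.single j 1)
      simpa [h, Pi.single_apply] using this.symm
    have : {μ : Fin k → ℝ | (m : ℝ) * r i ≤ ∑ j, μ j * (v i j : ℝ)}
        = φ ⁻¹' Set.Ici ((m : ℝ) * r i) := by
      ext μ
      simp [hφ]
    rw [this, ← (φ.isOpenMap_of_ne_zero hφ0).preimage_interior_eq_interior_preimage φ.continuous,
      interior_Ici]
    simp [hφ, hv]

lemma exists_lattice_point_strict (hb : Bornology.IsBounded (rationalPolyhedron v r))
    (hne : (rationalPolyhedron v r).Nonempty)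
    (hint : (interior (rationalPolyhedron v r)).Nonempty) :
    ∃ (x : Fin k → ℤ) (t : ℤ), 0 < t ∧ ∀ i, v i ≠ 0 → r i * t < ∑ j, x j * v i j := by
  have hdense : DenseRange (Pi.map fun (_ : Fin k) (z : ℚ) => (z : ℝ)) :=
    DenseRange.piMap fun _ => Rat.denseRange_cast
  obtain ⟨_, hzmem, z, rfl⟩ := hdense.inter_open_nonempty _ isOpen_interior hint
  have hz := (mem_interior_smul_rationalPolyhedron hb hne 1
    (Pi.map (fun (_ : Fin k) (z : ℚ) => (z : ℝ)) z)).mp (by simpa using hzmem)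
  have hden : ∀ j, ∃ x : ℤ, (x : ℚ) = z j * (∏ j, (z j).den : ℕ) := by
    intro j
    obtain ⟨c, hc⟩ := Finset.dvd_prod_of_mem (fun j => (z j).den) (Finset.mem_univ j)
    refine ⟨(z j).num * c, ?_⟩
    rw [hc]
    push_cast
    rw [← mul_assoc, Rat.mul_den_eq_num]
  choose x hx using hden
  have ht : 0 < ∏ j, (z j).den := Finset.prod_pos fun j _ => (z j).den_pos
  refine ⟨x, (∏ j, (z j).den : ℕ), by exact_mod_cast ht, fun i hi => ?_⟩
  have h1 := hz i hi
  have h2 : (r i : ℚ) < ∑ j, z j * (v i j : ℚ) := by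
    simp only [Nat.cast_one, one_mul, Pi.map_apply] at h1
    exact_mod_cast h1
  have h3 := mul_lt_mul_of_pos_right h2 (by exact_mod_cast ht : (0 : ℚ) < (∏ j, (z j).den : ℕ))
  rw [Finset.sum_mul] at h3
  have h4 : ∀ j, z j * (v i j : ℚ) * (∏ j, (z j).den : ℕ) = x j * v i j := fun j => by
    rw [hx]; ring
  rw [Finset.sum_congr rfl fun j _ => h4 j] at h3
  exact_mod_cast h3

lemma finite_lattice_points {S : Set (Fin k → ℝ)} (hS : Bornology.IsBounded S) :
    {x : Fin k → ℤ | (fun j => (x j : ℝ)) ∈ S}.Finite := by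
  obtain ⟨R, hR⟩ := hS.exists_norm_le
  refine (Set.finite_Icc (fun _ => -⌈R⌉) (fun _ => ⌈R⌉)).subset fun x hx => ?_
  have h : ∀ j, |x j| ≤ ⌈R⌉ := fun j => by
    have h1 := (norm_le_pi_norm (fun j => (x j : ℝ)) j).trans (hR _ hx)
    rw [Real.norm_eq_abs] at h1
    have h2 := h1.trans (Int.le_ceil R)
    exact_mod_cast h2
  exact ⟨fun j => (abs_le.mp (h j)).1, fun j => (abs_le.mp (h j)).2⟩

/-- The linear functional `(x, t) ↦ ∑ j, x j * w j - b * t`. -/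
def homogenizedFunctional (w : Fin k → ℤ) (b : ℤ) : (Fin k → ℤ) × ℤ →ₗ[ℤ] ℤ where
  toFun p := ∑ j, p.1 j * w j - b * p.2
  map_add' p q := by
    simp only [Prod.fst_add, Prod.snd_add, Pi.add_apply, add_mul, Finset.sum_add_distrib]
    ring
  map_smul' c p := by
    simp only [Prod.smul_fst, Prod.smul_snd, Pi.smul_apply, smul_eq_mul, mul_assoc,
      ← Finset.mul_sum, RingHom.id_apply]
    ring

variable (v r) in
/-- The functionals defining the cone over a polyhedron, without the trivial constraints. -/
def coneFunctionals : Option {i : Fin n // v i ≠ 0} → ((Fin k → ℤ) × ℤ →ₗ[ℤ] ℤ)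
  | none => LinearMap.snd ℤ _ _
  | some i => homogenizedFunctional (v i) (r i)

/-- The defect function of the cone over a polytope records the lattice points of the interiors
of the positive dilates, and of the negatives of the dilates. -/
lemma reciprocityDefect_coneFunctionals (hb : Bornology.IsBounded (rationalPolyhedron v r))
    (hne : (rationalPolyhedron v r).Nonempty) (m : ℕ) (x : Fin k → ℤ) :
    (0 < m → reciprocityDefect ⊤ Finset.univ (coneFunctionals v r) (x, (m : ℤ)) =
      if (fun j => (x j : ℝ)) ∈ interior ((m : ℝ) • rationalPolyhedron v r) then 1 else 0) ∧
    reciprocityDefect ⊤ Finset.univ (coneFunctionals v r) (x, -(m : ℤ)) =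
      if (fun j => ((-x) j : ℝ)) ∈ (m : ℝ) • rationalPolyhedron v r then (-1) ^ k else 0 := by
  have hrank : Module.finrank ℤ (⊤ : Submodule ℤ ((Fin k → ℤ) × ℤ)) = k + 1 := by
    rw [finrank_top, Module.finrank_prod]
    simp
  constructor
  · intro hm
    have e : (∀ i : {i : Fin n // v i ≠ 0}, r i * (m : ℤ) < ∑ j, x j * v i j) ↔
        ∀ i, v i ≠ 0 → (m : ℝ) * r i < ∑ j, (x j : ℝ) * (v i j : ℝ) := by
      rw [Subtype.forall]
      refine forall₂_congr fun i _ => ?_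
      rw [mul_comm]
      exact_mod_cast Iff.rfl
    rw [mem_interior_smul_rationalPolyhedron hb hne m, ← e]
    simp [reciprocityDefect, Option.forall, coneFunctionals, homogenizedFunctional, hm, hm.ne']
  · have e : (∀ i : {i : Fin n // v i ≠ 0}, ∑ j, x j * v i j ≤ r i * -(m : ℤ)) ↔
        ∀ i, (m : ℝ) * r i ≤ ∑ j, ((-x) j : ℝ) * (v i j : ℝ) := by
      rw [Subtype.forall]
      refine forall_congr' fun i => ?_
      by_cases hv : v i = 0
      · obtain ⟨p, hp⟩ := hne
        have hr : (r i : ℝ) ≤ 0 := by simpa [hv] using hp i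
        simpa [hv] using mul_nonpos_of_nonneg_of_nonpos (Nat.cast_nonneg (α := ℝ) m) hr
      · have : (m : ℝ) * r i ≤ ∑ j, ((-x) j : ℝ) * (v i j : ℝ) ↔
            (m : ℤ) * r i ≤ ∑ j, (-x) j * v i j := by exact_mod_cast Iff.rfl
        rw [this]
        simp only [Pi.neg_apply, neg_mul, Finset.sum_neg_distrib, hv, ne_eq, not_false_eq_true,
          forall_const, mul_neg]
        rw [le_neg, mul_comm]
    have h0 : (∀ i ∈ Finset.univ, coneFunctionals v r i (x, -(m : ℤ)) ≤ 0) ↔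
        ∀ i : {i : Fin n // v i ≠ 0}, ∑ j, x j * v i j ≤ r i * -(m : ℤ) := by
      simp only [Finset.mem_univ, forall_const, Option.forall]
      exact ⟨fun h i => sub_nonpos.mp (h.2 i),
        fun h => ⟨neg_nonpos.mpr (Int.natCast_nonneg m), fun i => sub_nonpos.mpr (h i)⟩⟩
    have h1 : ¬ ∀ i ∈ Finset.univ, 0 < coneFunctionals v r i (x, -(m : ℤ)) := fun h =>
      (h none (Finset.mem_univ _)).not_ge (neg_nonpos.mpr (Int.natCast_nonneg m))
    rw [mem_smul_rationalPolyhedron hb hne, ← e]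
    simp only [reciprocityDefect, h0, h1, hrank, Submodule.mem_top, true_and, if_false]
    split_ifs <;> ring

end Polyhedra

lemma finsum_ite_const {α : Type*} {S : Set α} (hS : S.Finite) (c : ℚ) :
    ∑ᶠ x, (if x ∈ S then c else 0) = c * S.ncard := by
  rw [finsum_eq_sum_of_support_subset (s := hS.toFinset) _ (by
    intro x hx
    by_contra hcon
    simp_all), Set.ncard_eq_toFinset_card S hS, Finset.sum_congr rfl
    (g := fun _ => c) fun x hx => if_pos (hS.mem_toFinset.mp hx)]
  simp [mul_comm]

/-- **Ehrhart reciprocity.** Let `P ⊂ ℝ^k` be a nonempty compact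
`k`-dimensional rational convex polytope with Ehrhart counting quasi-polynomial
`p(m) = #(ℤ^k ∩ mP)` (given by polynomials `q i` on the residue classes mod `l`).  Then for
every positive integer `m`, `p(−m) = (−1)^k · #(ℤ^k ∩ int(mP))`, where `p(−m)` is the
evaluation of the quasi-polynomial at `−m` (the index `(l − m % l) % l` being `−m mod l`). -/
theorem ehrhart_reciprocity
    (k : ℕ) (P : Set (Fin k → ℝ))
    (hrat : ∃ (n : ℕ) (v : Fin n → Fin k → ℤ) (r : Fin n → ℤ),
        P = {μ : Fin k → ℝ | ∀ i, (r i : ℝ) ≤ ∑ j, μ j * (v i j : ℝ)})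
    (hcpt : IsCompact P) (hne : P.Nonempty)
    (hdim : affineSpan ℝ P = ⊤)
    (l : ℕ) (hl : 0 < l)
    (q : ℕ → Polynomial ℚ)
    (hq : ∀ m : ℕ,
      (Set.ncard {x : Fin k → ℤ | (fun j => (x j : ℝ)) ∈ (m : ℝ) • P} : ℚ)
        = (q (m % l)).eval (m : ℚ)) :
    ∀ m : ℕ, 0 < m →
      (q ((l - m % l) % l)).eval (-(m : ℚ))
        = (-1 : ℚ) ^ k *
          (Set.ncard {x : Fin k → ℤ | (fun j => (x j : ℝ)) ∈ interior ((m : ℝ) • P)} : ℚ) := by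
  obtain ⟨n, v, r, hP⟩ := hrat
  obtain rfl : P = rationalPolyhedron v r := hP
  have hb := hcpt.isBounded
  have hconv : Convex ℝ (rationalPolyhedron v r) := by
    intro x hx y hy a b ha hb hab i
    have h1 := mul_le_mul_of_nonneg_left (hx i) ha
    have h2 := mul_le_mul_of_nonneg_left (hy i) hb
    simp only [Pi.add_apply, Pi.smul_apply, smul_eq_mul, add_mul, Finset.sum_add_distrib,
      mul_assoc, ← Finset.mul_sum]
    have h3 : (r i : ℝ) = a * r i + b * r i := by rw [← add_mul, hab, one_mul]
    linarith
  have hint := hconv.interior_nonempty_iff_affineSpan_eq_top.mpr hdim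
  set f := reciprocityDefect ⊤ Finset.univ (coneFunctionals v r) with hf
  have hpos : ∀ (m : ℕ), 0 < m → ∀ x : Fin k → ℤ, f (x, (m : ℤ)) =
      if x ∈ {x : Fin k → ℤ |
        (fun j => (x j : ℝ)) ∈ interior ((m : ℝ) • rationalPolyhedron v r)} then 1 else 0 :=
    fun m hm x => (reciprocityDefect_coneFunctionals hb hne m x).1 hm
  have hneg : ∀ (m : ℕ) (x : Fin k → ℤ), f (x, -(m : ℤ)) =
      if -x ∈ {x : Fin k → ℤ |
        (fun j => (x j : ℝ)) ∈ (m : ℝ) • rationalPolyhedron v r} then (-1) ^ k else 0 :=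
    fun m x => (reciprocityDefect_coneFunctionals hb hne m x).2
  have hfinA : ∀ m : ℕ, {x : Fin k → ℤ |
      (fun j => (x j : ℝ)) ∈ (m : ℝ) • rationalPolyhedron v r}.Finite :=
    fun m => finite_lattice_points (hb.smul₀ _)
  have hfinB : ∀ m : ℕ, {x : Fin k → ℤ |
      (fun j => (x j : ℝ)) ∈ interior ((m : ℝ) • rationalPolyhedron v r)}.Finite :=
    fun m => (hfinA m).subset fun x hx =>
      interior_subset (s := (m : ℝ) • rationalPolyhedron v r) hx
  have hfin : ∀ t, {x | f (x, t) ≠ 0}.Finite := by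
    intro t
    rcases lt_or_ge 0 t with ht | ht
    · obtain ⟨m, rfl⟩ := Int.eq_ofNat_of_zero_le ht.le
      refine (hfinB m).subset fun x hx => ?_
      by_contra hcon
      exact hx ((hpos m (by omega) x).trans (if_neg hcon))
    · obtain ⟨m, hm⟩ := Int.eq_ofNat_of_zero_le (neg_nonneg.mpr ht)
      obtain rfl : t = -(m : ℤ) := by rw [← hm, neg_neg]
      refine ((hfinA m).preimage neg_injective.injOn).subset fun x hx => ?_
      by_contra hcon
      exact hx ((hneg m x).trans (if_neg hcon))
  have htor : DiffTorsion {v | v ≠ 0} f := by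
    obtain ⟨x, t, ht, hx⟩ := exists_lattice_point_strict hb hne hint
    refine DiffTorsion.reciprocityDefect (y := (x, t)) Submodule.mem_top ?_
    rintro (_ | ⟨i, hi⟩) _
    · exact ht
    · exact sub_pos.mpr (hx i hi)
  have htor := (htor.transverse hfin).finsum_fiber hfin
  have hgpos : ∀ m : ℕ, 0 < m → ∑ᶠ x, f (x, (m : ℤ)) = (Set.ncard {x : Fin k → ℤ |
      (fun j => (x j : ℝ)) ∈ interior ((m : ℝ) • rationalPolyhedron v r)} : ℚ) := by
    intro m hm
    rw [finsum_congr (hpos m hm), finsum_ite_const (hfinB m), one_mul]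
  have hgneg : ∀ m : ℕ, ∑ᶠ x, f (x, -(m : ℤ)) = (-1) ^ k * (q (m % l)).eval (m : ℚ) := by
    intro m
    rw [finsum_congr (hneg m), ← hq, ← finsum_ite_const (hfinA m)]
    exact finsum_comp_equiv (Equiv.neg (Fin k → ℤ)) (f := fun x => if x ∈ {x : Fin k → ℤ |
      (fun j => (x j : ℝ)) ∈ (m : ℝ) • rationalPolyhedron v r} then (-1 : ℚ) ^ k else 0)
  let Q : ℤ → Polynomial ℚ := fun t => (q ((-t) % l).toNat).comp (-Polynomial.X)
  have hQper : ∀ t, Q (t + l) = Q t := by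
    intro t
    have : (-(t + l) : ℤ) % l = (-t) % l := by
      rw [neg_add, ← sub_eq_add_neg, Int.sub_emod_right]
    simp only [Q, this]
  have hQdeg : ∀ t, (Q t).natDegree < (Finset.range l).sup (fun i => (q i).natDegree) + 1 := by
    intro t
    have hlt : ((-t) % (l : ℤ)).toNat < l := by
      have := Int.emod_lt_of_pos (-t) (by exact_mod_cast hl : (0 : ℤ) < l)
      omega
    rw [Nat.lt_add_one_iff, Polynomial.natDegree_comp, Polynomial.natDegree_neg,
      Polynomial.natDegree_X, mul_one]
    exact Finset.le_sup (f := fun i => (q i).natDegree) (Finset.mem_range.mpr hlt)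
  have hzero := (htor.sub ((DiffTorsion.of_quasiPolynomial hl Q hQper _ hQdeg).const_smul
    ((-1) ^ k))).eq_zero_of_eventually ⟨0, fun t ht => by
      obtain ⟨m, hm⟩ := Int.eq_ofNat_of_zero_le (neg_nonneg.mpr ht)
      obtain rfl : t = -(m : ℤ) := by rw [← hm, neg_neg]
      have : ((m : ℤ) % l).toNat = m % l := by rw [← Int.natCast_mod, Int.toNat_natCast]
      simp [hgneg, Q, this]⟩
  intro m hm
  have hidx : ((-(m : ℤ)) % l).toNat = (l - m % l) % l := by
    have h1 : m % l < l := Nat.mod_lt m hl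
    have h2 : (-(m : ℤ)) % l = ((l - m % l : ℕ) : ℤ) % l := by
      rw [Nat.cast_sub h1.le, Int.natCast_mod, sub_eq_add_neg, Int.add_emod_left]
      exact (Int.mod_modEq (m : ℤ) l).neg.symm
    rw [h2, ← Int.natCast_mod, Int.toNat_natCast]
  have := congrFun hzero (m : ℤ)
  simp only [Pi.sub_apply, Pi.smul_apply, hgpos m hm, Pi.zero_apply, sub_eq_zero, smul_eq_mul, Q,
    hidx, Polynomial.eval_comp, Polynomial.eval_neg, Polynomial.eval_X, Int.cast_natCast] at this
  rw [this, ← mul_assoc, ← mul_pow, neg_one_mul, neg_neg, one_pow, one_mul]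
end
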